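/- arXiv:1410.0312 — 3 statements merged into one kernel-verified Lean document; each statement's English description precedes it below -/
import Mathlib

section
/- Let K be a field and R = K[x_0,...,x_N]. Let I ⊆ R be a strict almost complete intersection ideal defining a reduced set of points in P^N, with minimal generators f_1,...,f_{N+1}. Then I is of linear type; concretely, the kernel of the R-algebra homomorphism R[T_1,...,T_{N+1}] → R[t] sending T_i ↦ f_i·t (and fixing R) is generated by its elements that are homogeneous of degree 1 in the variables T_1,...,T_{N+1} (i.e., by the linear syzygy forms Σ b_i T_i with Σ b_i f_i = 0). -/
open MvPolynomial

noncomputable section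

/-- The ideal of `K[x₀,…]` generated by the homogeneous polynomials vanishing at
(a representative vector of) a point of projective space. -/
def pointIdeal {K : Type*} [Field K] {n : ℕ} (v : Fin n → K) :
    Ideal (MvPolynomial (Fin n) K) :=
  Ideal.span {f | (∃ d, f.IsHomogeneous d) ∧ eval v f = 0}

/-- `I` is the ideal of a finite nonempty set of distinct (reduced) points of
projective space, given by nonzero, pairwise non-proportional representative
vectors `p 0, …, p n`. -/
def DefinesReducedPoints {K : Type*} [Field K] {N : ℕ}
    (I : Ideal (MvPolynomial (Fin (N + 1)) K)) : Prop :=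
  ∃ (n : ℕ) (p : Fin (n + 1) → (Fin (N + 1) → K)),
    (∀ i, p i ≠ 0) ∧ (∀ i j, i ≠ j → ∀ t : K, p i ≠ t • p j) ∧
    I = ⨅ i, pointIdeal (p i)

/-- Coset prime avoidance. -/
theorem Ideal.exists_add_forall_notMem_prime {R : Type*} [CommRing R] (s : Finset (Ideal R))
    (hs : ∀ q ∈ s, q.IsPrime) (A : Ideal R) (x : R) (h : ∀ q ∈ s, x ∈ q → ¬ A ≤ q) :
    ∃ y ∈ A, ∀ q ∈ s, x + y ∉ q := by
  classical
  induction s using Finset.strongInduction with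
  | H s ih =>
    rcases s.eq_empty_or_nonempty with rfl | hne
    · exact ⟨0, A.zero_mem, by simp⟩
    obtain ⟨q₀, hq₀⟩ := s.exists_minimal hne
    have hmem : q₀ ∈ s := hq₀.prop
    have hprime := hs q₀ hmem
    obtain ⟨y, hyA, hy⟩ := ih (s.erase q₀) (Finset.erase_ssubset hmem)
      (fun q hq => hs q (Finset.mem_of_mem_erase hq)) fun q hq => h q (Finset.mem_of_mem_erase hq)
    by_cases hy₀ : x + y ∈ q₀
    · have hA : ¬ A ≤ q₀ := fun hle =>
        h q₀ hmem ((Ideal.add_mem_iff_left _ (hle hyA)).1 hy₀) hle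
      have hnot : ¬ A ⊓ (s.erase q₀).inf id ≤ q₀ := by
        rw [hprime.inf_le, hprime.inf_le']
        rintro (hle | ⟨q, hq, hle⟩)
        · exact hA hle
        · exact (Finset.ne_of_mem_erase hq)
            (le_antisymm hle (hq₀.le_of_le (Finset.mem_of_mem_erase hq) hle))
      obtain ⟨z, hz, hzq⟩ := SetLike.not_le_iff_exists.1 hnot
      refine ⟨y + z, A.add_mem hyA hz.1, fun q hq => ?_⟩
      rw [← add_assoc]
      by_cases hqq : q = q₀
      · subst hqq
        rwa [Ideal.add_mem_iff_right _ hy₀]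
      · have hq' := Finset.mem_erase.2 ⟨hqq, hq⟩
        have hzq' : z ∈ q := Finset.inf_le (f := id) hq' hz.2
        rw [Ideal.add_mem_iff_left _ hzq']
        exact hy q hq'
    · exact ⟨y, hyA, fun q hq => if hqq : q = q₀ then hqq ▸ hy₀ else
        hy q (Finset.mem_erase.2 ⟨hqq, hq⟩)⟩

/-- For pairwise incomparable primes, membership can be prescribed independently. -/
theorem Ideal.exists_mem_prime_iff {R ι : Type*} [CommRing R] [Finite ι] (P : ι → Ideal R)
    (hP : ∀ i, (P i).IsPrime) (hinc : ∀ i j, P i ≤ P j → i = j) (b : ι → Prop) :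
    ∃ a, ∀ i, a ∈ P i ↔ b i := by
  classical
  have := Fintype.ofFinite ι
  obtain ⟨a, ha, ha'⟩ := Ideal.exists_add_forall_notMem_prime
    ((Finset.univ.filter fun i => ¬ b i).image P)
    (by simpa using fun i _ => hP i)
    ((Finset.univ.filter b).inf P) 0 (by
      simp only [Finset.mem_image, Finset.mem_filter, Finset.mem_univ, true_and,
        forall_exists_index, and_imp]
      rintro _ i hi rfl - hle
      rw [(hP i).inf_le'] at hle
      obtain ⟨j, hj, hle⟩ := hle
      obtain rfl := hinc _ _ hle
      simp_all)
  refine ⟨a, fun i => ⟨fun hi => ?_, fun hi => Finset.inf_le (f := P) (by simpa using hi) ha⟩⟩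
  by_contra hb
  exact ha' (P i) (Finset.mem_image_of_mem P (by simpa using hb)) (by simpa using hi)

open RingTheory.Sequence CategoryTheory Abelian Limits in
theorem RingTheory.Sequence.IsWeaklyRegular.subsingleton_linearMap_quotient.{u} {R : Type u}
    [CommRing R] (N : ModuleCat.{u} R) (rs : List R) (M : ModuleCat.{u} R) (n : ℕ)
    (hrs : rs.length < n)
    (hM : IsWeaklyRegular M rs) (hExt : ∀ i < n, Subsingleton (Ext N M i)) :
    Subsingleton (N →ₗ[R] (M ⧸ (Ideal.ofList rs • ⊤ : Submodule R M))) := by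
  induction rs generalizing M n with
  | nil =>
    have : Subsingleton (N ⟶ M) := Ext.addEquiv₀.subsingleton_congr.mp (hExt 0 (by simpa using hrs))
    have : Subsingleton (N →ₗ[R] M) := ModuleCat.homAddEquiv.symm.subsingleton
    exact ((Submodule.quotEquivOfEqBot (Ideal.ofList [] • ⊤ : Submodule R M)
      (by simp)).congrRight (M := N)).toEquiv.subsingleton
  | cons r rs ih =>
    rw [isWeaklyRegular_cons_iff] at hM
    have key := ih (ModuleCat.of R (QuotSMulTop r M)) (n - 1)
      (by simp only [List.length_cons] at hrs; omega) hM.2 (by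
        intro i hi
        have zero1 := AddCommGrpCat.isZero_of_iff_subsingleton.mpr (hExt i (by omega))
        have zero2 := AddCommGrpCat.isZero_of_iff_subsingleton.mpr (hExt (i + 1) (by omega))
        exact AddCommGrpCat.subsingleton_of_isZero <| ShortComplex.Exact.isZero_of_both_zeros
          ((Ext.covariant_sequence_exact₃' N hM.1.smulShortComplex_shortExact) i (i + 1) rfl)
          (zero1.eq_zero_of_src _) (zero2.eq_zero_of_tgt _))
    exact ((Submodule.quotOfListConsSMulTopEquivQuotSMulTopInner M r rs).congrRight
      (M := N)).toEquiv.subsingleton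

open RingTheory.Sequence CategoryTheory Abelian Limits in
/-- A proper ideal containing a regular sequence longer than the regular sequence `as` does not
annihilate any nonzero element modulo `as`. -/
theorem RingTheory.Sequence.IsWeaklyRegular.mem_ofList_of_mul_mem {R : Type*} [CommRing R]
    [IsNoetherianRing R] {q : Ideal R} (hq : q ≠ ⊤) {rs as : List R}
    (hrs : IsWeaklyRegular R rs) (hrq : ∀ r ∈ rs, r ∈ q) (has : IsWeaklyRegular R as)
    (hlen : as.length < rs.length) {x : R} (hx : ∀ a ∈ q, a * x ∈ Ideal.ofList as) :
    x ∈ Ideal.ofList as := by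
  have hle : Ideal.ofList rs ≤ q := Ideal.span_le.2 hrq
  have hreg : IsRegular R rs := ⟨hrs, by
    intro h
    rw [smul_eq_mul, Ideal.mul_top] at h
    exact hq (top_le_iff.1 (h.trans_le hle))⟩
  have hExt := ModuleCat.subsingleton_ext_of_exists_isRegular q (ModuleCat.of R (R ⧸ q))
    (by rw [Module.support_eq_zeroLocus, Ideal.annihilator_quotient]) (ModuleCat.of R R)
    (by simpa using hq.lt_top) rs hrq hreg
  have := IsWeaklyRegular.subsingleton_linearMap_quotient (ModuleCat.of R (R ⧸ q)) as
    (ModuleCat.of R R) _ hlen has hExt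
  let f : (R ⧸ q) →ₗ[R] (R ⧸ (Ideal.ofList as • ⊤ : Submodule R R)) :=
    Submodule.liftQ q (LinearMap.toSpanSingleton R _ (Submodule.Quotient.mk x)) fun a ha => by
      rw [LinearMap.mem_ker, LinearMap.toSpanSingleton_apply, ← Submodule.Quotient.mk_smul,
        Submodule.Quotient.mk_eq_zero, smul_eq_mul, smul_eq_mul, Ideal.mul_top]
      exact hx a ha
  have hf : f = 0 := Subsingleton.elim (α := (ModuleCat.of R (R ⧸ q) : Type _) →ₗ[R] _) _ _
  have := LinearMap.congr_fun hf (Submodule.Quotient.mk 1)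
  rw [Submodule.liftQ_apply, LinearMap.toSpanSingleton_apply, one_smul, LinearMap.zero_apply,
    Submodule.Quotient.mk_eq_zero, smul_eq_mul, Ideal.mul_top] at this
  exact this

/-- The `R`-algebra map `R[T] → R[t]`, `Tᵢ ↦ fᵢ t`, whose image is the Rees algebra of `(f)`. -/
def reesMap {ι R : Type*} [CommRing R] (f : ι → R) : MvPolynomial ι R →ₐ[R] Polynomial R :=
  aeval fun i => Polynomial.C (f i) * Polynomial.X

/-- The ideal generated by the linear forms in the kernel of `reesMap f`. -/
def linearSyzygyIdeal {ι R : Type*} [CommRing R] (f : ι → R) : Ideal (MvPolynomial ι R) :=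
  Ideal.span {F | F ∈ RingHom.ker (reesMap f) ∧ F.IsHomogeneous 1}

section LinearType

variable {ι κ R : Type*} [CommRing R]

theorem reesMap_of_isHomogeneous (f : ι → R) {F : MvPolynomial ι R} {d : ℕ}
    (hF : F.IsHomogeneous d) :
    reesMap f F = Polynomial.C (aeval f F) * Polynomial.X ^ d := by
  simp only [reesMap, aeval_def, eval₂_eq, map_sum, Finset.sum_mul]
  refine Finset.sum_congr rfl fun m hm => ?_
  have hd : ∑ i ∈ m.support, m i = d := hF.degree_eq_sum_deg_support hm |>.symm
  simp only [mul_pow, Finset.prod_mul_distrib, Finset.prod_pow_eq_pow_sum, hd, map_mul, map_prod,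
    map_pow, ← mul_assoc]
  rfl

theorem reesMap_coeff (f : ι → R) (F : MvPolynomial ι R) (d : ℕ) :
    (reesMap f F).coeff d = aeval f (homogeneousComponent d F) := by
  conv_lhs => rw [← sum_homogeneousComponent F, map_sum]
  simp only [Polynomial.finsetSum_coeff,
    reesMap_of_isHomogeneous f (homogeneousComponent_isHomogeneous _ _),
    Polynomial.coeff_C_mul_X_pow]
  rw [Finset.sum_ite_eq]
  split_ifs with h
  · rfl
  · rw [homogeneousComponent_eq_zero _ _ (by simpa [Nat.lt_succ_iff] using h), map_zero]

theorem mem_ker_reesMap_iff (f : ι → R) (F : MvPolynomial ι R) :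
    F ∈ RingHom.ker (reesMap f) ↔ ∀ d, aeval f (homogeneousComponent d F) = 0 := by
  simp [RingHom.mem_ker, Polynomial.ext_iff, reesMap_coeff]

theorem linearSyzygyIdeal_le_ker (f : ι → R) : linearSyzygyIdeal f ≤ RingHom.ker (reesMap f) :=
  Ideal.span_le.2 fun _ h => h.1

theorem mem_linearSyzygyIdeal (f : ι → R) {F : MvPolynomial ι R} (hF : F.IsHomogeneous 1)
    (h : aeval f F = 0) : F ∈ linearSyzygyIdeal f :=
  Ideal.subset_span ⟨by rw [RingHom.mem_ker, reesMap_of_isHomogeneous f hF, h]; simp, hF⟩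

/-- Substitution of linear forms. -/
theorem map_linearSyzygyIdeal_le [Fintype κ] (f : ι → R) (g : κ → R) (B : ι → κ → R)
    (hB : ∀ i, f i = ∑ k, B i k * g k) :
    (linearSyzygyIdeal f).map (aeval (R := R) fun i => ∑ k, C (B i k) * X k) ≤
      linearSyzygyIdeal g := by
  have hlin : ∀ i, (∑ k, C (B i k) * X k : MvPolynomial κ R).IsHomogeneous 1 := fun i =>
    IsHomogeneous.sum _ _ _ fun k _ => isHomogeneous_C_mul_X _ _
  rw [linearSyzygyIdeal, Ideal.map_span, Ideal.span_le]
  rintro _ ⟨F, ⟨hF, hF1⟩, rfl⟩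
  refine mem_linearSyzygyIdeal g (by simpa using hF1.aeval _ hlin) ?_
  rw [mem_ker_reesMap_iff] at hF
  have h0 := hF 1
  rw [homogeneousComponent_eq_self hF1] at h0
  rw [← h0, ← AlgHom.comp_apply]
  congr 1
  ext i
  simp [hB]

/-- Being of linear type does not depend on the generators. -/
theorem ker_reesMap_le_of_span_eq [Fintype ι] [Fintype κ] (f : ι → R) (g : κ → R)
    (h : Ideal.span (Set.range f) = Ideal.span (Set.range g))
    (hg : RingHom.ker (reesMap g) ≤ linearSyzygyIdeal g) :
    RingHom.ker (reesMap f) ≤ linearSyzygyIdeal f := by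
  have hfg : ∀ i, ∃ c : κ → R, ∑ k, c k * g k = f i := fun i =>
    Ideal.mem_span_range_iff_exists_fun.1 (h ▸ Ideal.subset_span ⟨i, rfl⟩)
  have hgf : ∀ k, ∃ c : ι → R, ∑ i, c i * f i = g k := fun k =>
    Ideal.mem_span_range_iff_exists_fun.1 (h ▸ Ideal.subset_span ⟨k, rfl⟩)
  choose A hA using hfg
  choose B hB using hgf
  let a : MvPolynomial ι R →ₐ[R] MvPolynomial κ R := aeval fun i => ∑ k, C (A i k) * X k
  let b : MvPolynomial κ R →ₐ[R] MvPolynomial ι R := aeval fun k => ∑ i, C (B k i) * X i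
  intro F hF
  have ha : (reesMap g).comp a = reesMap f := by
    ext1 i
    simp [a, reesMap, ← hA, Finset.sum_mul, mul_assoc]
  have h1 : a F ∈ RingHom.ker (reesMap g) := by
    rw [RingHom.mem_ker, ← AlgHom.comp_apply, ha]; exact hF
  have h2 : b (a F) ∈ linearSyzygyIdeal f :=
    map_linearSyzygyIdeal_le g f B (fun k => (hB k).symm) (Ideal.mem_map_of_mem b (hg h1))
  have h3 : (Ideal.Quotient.mkₐ R (linearSyzygyIdeal f)).comp (b.comp a) =
      Ideal.Quotient.mkₐ R (linearSyzygyIdeal f) := by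
    ext1 i
    simp only [AlgHom.comp_apply, Ideal.Quotient.mkₐ_eq_mk]
    rw [Ideal.Quotient.mk_eq_mk_iff_sub_mem]
    refine mem_linearSyzygyIdeal f (IsHomogeneous.sub ?_ (isHomogeneous_X _ _)) ?_
    · simp only [a, b, aeval_X, map_sum, map_mul, algHom_C, algebraMap_eq]
      refine IsHomogeneous.sum _ _ _ fun k _ => IsHomogeneous.C_mul ?_ _
      exact IsHomogeneous.sum _ _ _ fun k _ => isHomogeneous_C_mul_X _ _
    · simp [a, b, hA, hB]
  have h4 := AlgHom.congr_fun h3 F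
  simp only [AlgHom.comp_apply, Ideal.Quotient.mkₐ_eq_mk] at h4
  rw [Ideal.Quotient.mk_eq_mk_iff_sub_mem] at h4
  simpa using Ideal.sub_mem _ h2 h4

attribute [local instance] MvPolynomial.gradedAlgebra

/-- Elements of degree `d + 1` of an ideal generated by linear forms and one more variable. -/
theorem exists_isHomogeneous_sub_X_mul_mem {s : Set (MvPolynomial ι R)}
    (hs : ∀ F ∈ s, F.IsHomogeneous 1) (i : ι) {F : MvPolynomial ι R} {d : ℕ}
    (hF : F.IsHomogeneous (d + 1)) (h : F ∈ Ideal.span s ⊔ Ideal.span {X i}) :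
    ∃ G : MvPolynomial ι R, G.IsHomogeneous d ∧ F - X i * G ∈ Ideal.span s := by
  obtain ⟨a, ha, b, hb, rfl⟩ := Submodule.mem_sup.1 h
  obtain ⟨G, rfl⟩ := Ideal.mem_span_singleton'.1 hb
  refine ⟨homogeneousComponent d G, homogeneousComponent_isHomogeneous _ _, ?_⟩
  have hhom : (Ideal.span s).IsHomogeneous (homogeneousSubmodule ι R) :=
    Ideal.homogeneous_span _ _ fun F hF => ⟨1, hs F hF⟩
  have h1 := homogeneousComponent_eq_self hF
  have h2 : homogeneousComponent (d + 1) (G * X i) = X i * homogeneousComponent d G := by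
    have := DirectSum.coe_decompose_mul_add_of_left_mem (homogeneousSubmodule ι R) (i := 1)
      (j := d) (a := X i) (b := G) (isHomogeneous_X R i)
    rw [mul_comm, add_comm, ← decomposition.decompose'_apply, ← decomposition.decompose'_apply]
    exact this
  rw [map_add, h2] at h1
  have h3 := homogeneousComponent_mem_of_mem hhom ha (d + 1)
  rwa [← h1, add_sub_cancel_right]

/-- A Huneke-type criterion: an ideal generated by a relative regular sequence is of linear
type. -/
theorem ker_reesMap_le_of_colon {n : ℕ} (f : Fin n → R)
    (hf : ∀ i : Fin n, ∀ x ∈ Ideal.span (Set.range f), x * f i ∈ Ideal.span (f '' {j | j < i}) →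
      x ∈ Ideal.span (f '' {j | j < i})) :
    RingHom.ker (reesMap f) ≤ linearSyzygyIdeal f := by
  have hirr : ∀ {d : ℕ} {F : MvPolynomial (Fin n) R}, F.IsHomogeneous (d + 1) →
      F ∈ Ideal.span (Set.range (X : Fin n → MvPolynomial (Fin n) R)) := by
    intro d F hF
    rw [← Set.image_univ, mem_ideal_span_X_image]
    intro m hm
    have := hF (mem_support_iff.1 hm)
    by_contra! hc
    have : m = 0 := by ext i; exact hc i trivial
    simp_all
  have key : ∀ d k : ℕ, k ≤ n → ∀ F : MvPolynomial (Fin n) R, F.IsHomogeneous (d + 1) →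
      aeval f F ∈ Ideal.span (f '' {j : Fin n | (j : ℕ) < k}) →
      F ∈ linearSyzygyIdeal f ⊔ Ideal.span (X '' {j : Fin n | (j : ℕ) < k}) := by
    have hS : ∀ k : ℕ, linearSyzygyIdeal f ⊔ Ideal.span (X '' {j : Fin n | (j : ℕ) < k}) =
        Ideal.span ({F | F ∈ RingHom.ker (reesMap f) ∧ F.IsHomogeneous 1} ∪
          X '' {j : Fin n | (j : ℕ) < k}) := fun k => (Ideal.span_union _ _).symm
    have hS1 : ∀ k : ℕ, ∀ F ∈ ({F | F ∈ RingHom.ker (reesMap f) ∧ F.IsHomogeneous 1} ∪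
        X '' {j : Fin n | (j : ℕ) < k} : Set (MvPolynomial (Fin n) R)), F.IsHomogeneous 1 := by
      rintro k F (hF | ⟨j, -, rfl⟩)
      · exact hF.2
      · exact isHomogeneous_X _ _
    have hval : ∀ k : ℕ, ∀ F ∈ linearSyzygyIdeal f ⊔ Ideal.span (X '' {j : Fin n | (j : ℕ) < k}),
        aeval f F ∈ Ideal.span (f '' {j : Fin n | (j : ℕ) < k}) := by
      intro k F hF
      suffices h : linearSyzygyIdeal f ⊔ Ideal.span (X '' {j : Fin n | (j : ℕ) < k}) ≤
          (Ideal.span (f '' {j : Fin n | (j : ℕ) < k})).comap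
            (aeval f : MvPolynomial (Fin n) R →ₐ[R] R)
        from h hF
      rw [hS, Ideal.span_le]
      rintro F (hF | ⟨j, hj, rfl⟩)
      · have := (mem_ker_reesMap_iff f F).1 hF.1 1
        rw [homogeneousComponent_eq_self hF.2] at this
        rw [SetLike.mem_coe, Ideal.mem_comap, this]
        exact Ideal.zero_mem _
      · simpa using Ideal.subset_span (Set.mem_image_of_mem f hj)
    have hlift : ∀ k : ℕ, ∀ y ∈ Ideal.span (f '' {j : Fin n | (j : ℕ) < k}),
        ∃ F : MvPolynomial (Fin n) R, F.IsHomogeneous 1 ∧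
          F ∈ Ideal.span (X '' {j : Fin n | (j : ℕ) < k}) ∧ aeval f F = y := by
      intro k y hy
      induction hy using Submodule.span_induction with
      | mem y hy =>
        obtain ⟨j, hj, rfl⟩ := hy
        exact ⟨X j, isHomogeneous_X _ _, Ideal.subset_span (Set.mem_image_of_mem X hj), by simp⟩
      | zero => exact ⟨0, isHomogeneous_zero _ _ _, Ideal.zero_mem _, by simp⟩
      | add y z _ _ hy hz =>
        obtain ⟨F, hF, hF', rfl⟩ := hy
        obtain ⟨G, hG, hG', rfl⟩ := hz
        exact ⟨F + G, hF.add hG, Ideal.add_mem _ hF' hG', by simp⟩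
      | smul c y _ hy =>
        obtain ⟨F, hF, hF', rfl⟩ := hy
        exact ⟨C c * F, hF.C_mul c, Ideal.mul_mem_left _ _ hF', by simp⟩
    intro d
    induction d using Nat.strong_induction_on with
    | h d ihd =>
    intro k hk
    induction hk using Nat.decreasingInduction with
    | self =>
      intro F hF _
      refine Ideal.mem_sup_right ?_
      convert hirr hF
      rw [← Set.image_univ]
      congr 1
      ext j
      simp
    | of_succ k hk ihk =>
      intro F hF hFk
      have hset : {j : Fin n | (j : ℕ) < k + 1} = {j : Fin n | (j : ℕ) < k} ∪ {⟨k, hk⟩} := by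
        ext j
        simp [Fin.ext_iff, le_iff_eq_or_lt]
      have hmem := ihk F hF (Ideal.span_mono (Set.image_mono fun j hj => by
        simp only [Set.mem_ofPred_eq] at hj ⊢; omega) hFk)
      rw [hset, Set.image_union, Set.image_singleton, Ideal.span_union, ← sup_assoc, hS] at hmem
      obtain ⟨G, hG, hFG⟩ := exists_isHomogeneous_sub_X_mul_mem (hS1 k) _ hF hmem
      rw [← hS] at hFG
      have hfG : aeval f G * f ⟨k, hk⟩ ∈ Ideal.span (f '' {j : Fin n | (j : ℕ) < k}) := by
        have := Ideal.sub_mem _ hFk (hval k _ hFG)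
        rwa [map_sub, sub_sub_cancel, map_mul, aeval_X, mul_comm] at this
      suffices h : X ⟨k, hk⟩ * G ∈
          linearSyzygyIdeal f ⊔ Ideal.span (X '' {j : Fin n | (j : ℕ) < k}) by
        simpa using Ideal.add_mem _ hFG h
      cases d with
      | zero =>
        obtain ⟨H, hH, hHk, hHG⟩ := hlift k _ hfG
        have hsub : X ⟨k, hk⟩ * G - H ∈ linearSyzygyIdeal f :=
          mem_linearSyzygyIdeal f (((isHomogeneous_X _ _).mul hG).sub hH)
            (by rw [map_sub, map_mul, aeval_X, hHG, mul_comm, sub_self])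
        simpa using Ideal.add_mem _ (Ideal.mem_sup_left hsub) (Ideal.mem_sup_right hHk)
      | succ d =>
        refine Ideal.mul_mem_left _ _ (ihd d (Nat.lt_succ_self _) k hk.le G hG ?_)
        refine hf ⟨k, hk⟩ _ ?_ hfG
        have := Ideal.mem_map_of_mem (aeval f : MvPolynomial (Fin n) R →ₐ[R] R) (hirr hG)
        rw [Ideal.map_span, ← Set.range_comp] at this
        convert this
        ext j
        simp
  intro F hF
  rw [mem_ker_reesMap_iff] at hF
  rw [← sum_homogeneousComponent F]
  refine Ideal.sum_mem _ fun d _ => ?_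
  cases d with
  | zero =>
    have := hF 0
    rw [homogeneousComponent_zero, aeval_C] at this
    rw [homogeneousComponent_zero]
    simp_all
  | succ d =>
    simpa using key d 0 (n.zero_le) _ (homogeneousComponent_isHomogeneous _ _) (by simp [hF])

end LinearType

section RegularSequences

theorem update_image_Iio {R : Type*} (g : ℕ → R) {i k : ℕ} (hik : i ≤ k) (v : R) :
    Function.update g k v '' Set.Iio i = g '' Set.Iio i :=
  Set.image_congr fun j hj => Function.update_of_ne (by simp at hj; omega) _ _

variable {R : Type*} [CommRing R]

/-- The first `k` terms of the sequence `g` form a weakly regular sequence. -/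
def IsRegularUpTo (g : ℕ → R) (k : ℕ) : Prop :=
  ∀ i < k, ∀ x, x * g i ∈ Ideal.span (g '' Set.Iio i) → x ∈ Ideal.span (g '' Set.Iio i)

theorem ofList_map_range (g : ℕ → R) (k : ℕ) :
    Ideal.ofList ((List.range k).map g) = Ideal.span (g '' Set.Iio k) := by
  rw [Ideal.ofList]
  congr 1
  ext x
  simp

theorem IsRegularUpTo.isWeaklyRegular {g : ℕ → R} {k : ℕ} (h : IsRegularUpTo g k) :
    RingTheory.Sequence.IsWeaklyRegular R ((List.range k).map g) := by
  refine ⟨fun i hi => ?_⟩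
  have hik : i < k := by simpa using hi
  rw [← List.map_take, List.take_range, min_eq_left hik.le, ofList_map_range, smul_eq_mul,
    Ideal.mul_top, isSMulRegular_quotient_iff_mem_of_smul_mem]
  intro x hx
  refine h i hik x ?_
  simpa [mul_comm] using hx

theorem IsRegularUpTo.mem_span_of_mul_mem [IsNoetherianRing R] {q : Ideal R} (hq : q ≠ ⊤)
    {l g : ℕ → R} {n k : ℕ} (hl : IsRegularUpTo l n) (hlq : ∀ i < n, l i ∈ q)
    (hg : IsRegularUpTo g k) (hkn : k < n) {x : R}
    (hx : ∀ a ∈ q, a * x ∈ Ideal.span (g '' Set.Iio k)) : x ∈ Ideal.span (g '' Set.Iio k) := by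
  rw [← ofList_map_range] at hx ⊢
  exact hl.isWeaklyRegular.mem_ofList_of_mul_mem hq (by simpa using hlq) hg.isWeaklyRegular
    (by simpa using hkn) hx

theorem IsRegularUpTo.update {g : ℕ → R} {k : ℕ} (hg : IsRegularUpTo g k) {v : R}
    (hv : ∀ x, x * v ∈ Ideal.span (g '' Set.Iio k) → x ∈ Ideal.span (g '' Set.Iio k)) :
    IsRegularUpTo (Function.update g k v) (k + 1) := by
  intro i hi
  rw [update_image_Iio g (by omega)]
  rcases eq_or_ne i k with rfl | hne
  · simpa using hv
  · rw [Function.update_of_ne hne]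
    exact hg i (by omega)

/-- Over the quotient by a prime `P` generated by `N` elements, `N + 1` elements of `P` satisfy a
nontrivial linear relation modulo `P * I`, if `I` agrees with `P` locally at `P`. -/
theorem exists_relation_mod_mul {N : ℕ} {P I : Ideal R} (hP : P.IsPrime) {l f : ℕ → R}
    (hl : Ideal.span (l '' Set.Iio N) = P) (hf : ∀ j < N + 1, f j ∈ P) {s : R} (hs : s ∉ P)
    (hsP : ∀ x ∈ P, s * x ∈ I) :
    ∃ c : ℕ → R, (∃ j < N + 1, c j ∉ P) ∧ ∑ j ∈ Finset.range (N + 1), c j * f j ∈ P * I := by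
  have hl' : Ideal.span (Set.range fun k : Fin N => l k) = P := by
    rw [← hl]
    congr 1
    ext x
    simp [Fin.exists_iff]
  have hb : ∀ j : Fin (N + 1), ∃ b : Fin N → R, ∑ k, b k * l k = f j := fun j =>
    Ideal.mem_span_range_iff_exists_fun.1 (hl' ▸ hf j j.2)
  choose b hb using hb
  let B : Matrix (Fin (N + 1)) (Fin N) (R ⧸ P) := .of fun j k => Ideal.Quotient.mk P (b j k)
  have hB : ¬ Function.Injective B.vecMulLinear := fun h => by
    simpa using card_le_of_injective (R ⧸ P) _ h
  rw [← LinearMap.ker_eq_bot, Submodule.eq_bot_iff] at hB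
  push Not at hB
  obtain ⟨v, hv, hv0⟩ := hB
  choose c hc using fun j => Ideal.Quotient.mk_surjective (v j)
  obtain ⟨j₀, hj₀⟩ := Function.ne_iff.1 hv0
  refine ⟨fun j => if h : j < N + 1 then s * c ⟨j, h⟩ else 0, ⟨j₀, j₀.2, ?_⟩, ?_⟩
  · simp only [Fin.is_lt, dite_true, Fin.eta]
    refine hP.mul_notMem hs fun h => hj₀ ?_
    rw [← hc, Ideal.Quotient.eq_zero_iff_mem.2 h, Pi.zero_apply]
  · have hk : ∀ k, ∑ j, c j * b j k ∈ P := fun k => by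
      rw [← Ideal.Quotient.eq_zero_iff_mem]
      have := congrFun (LinearMap.mem_ker.1 hv) k
      simpa [Matrix.vecMul, dotProduct, B, hc] using this
    have : ∑ j : Fin (N + 1), s * c j * f j = ∑ k, (∑ j, c j * b j k) * (s * l k) := by
      simp_rw [← hb, Finset.mul_sum, Finset.sum_mul]
      rw [Finset.sum_comm]
      exact Finset.sum_congr rfl fun k _ => Finset.sum_congr rfl fun j _ => by ring
    rw [Finset.sum_range]
    simp only [Fin.is_lt, dite_true, Fin.eta, this]
    exact Ideal.sum_mem _ fun k _ => Ideal.mul_mem_mul (hk k)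
      (hsP _ (hl ▸ Ideal.subset_span ⟨k, k.2, rfl⟩))

end RegularSequences

section IntersectionOfPrimes

variable {R ι : Type*} [CommRing R] [Finite ι] {P : ι → Ideal R} {N : ℕ} {l : ι → ℕ → R}

/-- A change of `N + 1` generators of an intersection of primes after which the first `N` of them
generate the ideal locally at each of the primes. -/
theorem exists_generators_locally_span (hP : ∀ i, (P i).IsPrime)
    (hinc : ∀ i j, P i ≤ P j → i = j) (hl : ∀ i, Ideal.span (l i '' Set.Iio N) = P i)
    {f : ℕ → R} (hf : Ideal.span (f '' Set.Iio (N + 1)) = ⨅ i, P i) :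
    ∃ g : ℕ → R, Ideal.span (g '' Set.Iio (N + 1)) = ⨅ i, P i ∧
      ∀ i, ∃ u ∉ P i, u * g N ∈ Ideal.span (g '' Set.Iio N) ⊔ P i * ⨅ i, P i := by
  classical
  have hs : ∀ i, ∃ s ∉ P i, ∀ x ∈ P i, s * x ∈ ⨅ i, P i := by
    intro i
    obtain ⟨s, hs⟩ := Ideal.exists_mem_prime_iff P hP hinc (· ≠ i)
    refine ⟨s, by simp [hs], fun x hx => (Ideal.mem_iInf).2 fun j => ?_⟩
    by_cases hj : j = i
    · exact Ideal.mul_mem_left _ _ (hj ▸ hx)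
    · exact Ideal.mul_mem_right _ _ ((hs j).2 hj)
  choose s hs hsP using hs
  have hfP : ∀ i, ∀ j < N + 1, f j ∈ P i := fun i j hj =>
    iInf_le P i (hf ▸ Ideal.subset_span ⟨j, hj, rfl⟩)
  choose c hc hcf using fun i => exists_relation_mod_mul (hP i) (hl i) (hfP i) (hs i) (hsP i)
  choose m hm hmc using hc
  choose a ha using fun j : ℕ => Ideal.exists_mem_prime_iff P hP hinc
    (fun i => ¬ (c i N ∈ P i ∧ m i = j))
  let g : ℕ → R := fun j => if j < N then f j + a j * f N else f j
  have hgN : g N = f N := by simp [g]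
  have hg : ∀ j < N, g j = f j + a j * f N := fun j hj => by simp [g, hj]
  refine ⟨g, ?_, fun i => ⟨c i N - ∑ j ∈ Finset.range N, c i j * a j, ?_, ?_⟩⟩
  · rw [← hf]
    have hfmem : ∀ j < N + 1, f j ∈ Ideal.span (f '' Set.Iio (N + 1)) := fun j hj =>
      Ideal.subset_span ⟨j, hj, rfl⟩
    have hgmem : ∀ j < N + 1, g j ∈ Ideal.span (g '' Set.Iio (N + 1)) := fun j hj =>
      Ideal.subset_span ⟨j, hj, rfl⟩
    apply le_antisymm <;> rw [Ideal.span_le] <;> rintro _ ⟨j, hj, rfl⟩ <;>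
      rcases (Nat.lt_succ_iff_lt_or_eq.1 hj) with hj' | rfl
    · rw [hg j hj']
      exact Ideal.add_mem _ (hfmem j hj) (Ideal.mul_mem_left _ _ (hfmem N N.lt_succ_self))
    · rw [hgN]; exact hfmem _ hj
    · have : f j = g j - a j * g N := by rw [hg j hj', hgN]; ring
      rw [this]
      exact Ideal.sub_mem _ (hgmem j hj) (Ideal.mul_mem_left _ _ (hgmem N N.lt_succ_self))
    · rw [← hgN]; exact hgmem _ hj
  · by_cases hcN : c i N ∈ P i
    · rw [Submodule.sub_mem_iff_right _ hcN]
      have hmN : m i < N := lt_of_le_of_ne (Nat.lt_succ_iff.1 (hm i)) fun h => hmc i (h ▸ hcN)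
      rw [← Finset.add_sum_erase _ _ (Finset.mem_range.2 hmN), Ideal.add_mem_iff_left]
      · exact (hP i).mul_notMem (hmc i) (by simp [ha, hcN])
      · refine Ideal.sum_mem _ fun j hj => Ideal.mul_mem_left _ _ ((ha j i).2 ?_)
        exact fun h => Finset.ne_of_mem_erase hj h.2.symm
    · rw [Submodule.sub_mem_iff_left]
      · exact hcN
      · exact Ideal.sum_mem _ fun j _ => Ideal.mul_mem_left _ _ ((ha j i).2 fun h => hcN h.1)
  · have : (c i N - ∑ j ∈ Finset.range N, c i j * a j) * g N =
        -(∑ j ∈ Finset.range N, c i j * g j) + ∑ j ∈ Finset.range (N + 1), c i j * f j := by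
      have hsum : ∑ j ∈ Finset.range N, c i j * g j = ∑ j ∈ Finset.range N, c i j * f j +
          (∑ j ∈ Finset.range N, c i j * a j) * f N := by
        rw [Finset.sum_mul, ← Finset.sum_add_distrib]
        exact Finset.sum_congr rfl fun j hj => by rw [hg j (Finset.mem_range.1 hj)]; ring
      rw [Finset.sum_range_succ, hgN, hsum]
      ring
    rw [this]
    exact Submodule.add_mem_sup (Ideal.neg_mem_iff _ |>.2 <| Ideal.sum_mem _ fun j hj =>
      Ideal.mul_mem_left _ _ (Ideal.subset_span ⟨j, Finset.mem_range.1 hj, rfl⟩)) (hcf i)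

variable [IsNoetherianRing R]

/-- Associated primes of a regular sequence of length at most `N` that contain the intersection
of the primes `P i`, each generated by a regular sequence of length `N`. -/
theorem exists_eq_of_associated (hP : ∀ i, (P i).IsPrime)
    (hl : ∀ i, Ideal.span (l i '' Set.Iio N) = P i) (hreg : ∀ i, IsRegularUpTo (l i) N)
    {g : ℕ → R} {k : ℕ} (hg : IsRegularUpTo g k) (hk : k ≤ N) {q : Ideal R} (hq : q.IsPrime)
    (hle : ⨅ i, P i ≤ q) {y : R} (hy : ∀ a, a ∈ q ↔ a * y ∈ Ideal.span (g '' Set.Iio k)) :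
    k = N ∧ ∃ i, q = P i := by
  have := Fintype.ofFinite ι
  obtain ⟨i, hi⟩ : ∃ i, P i ≤ q := by
    rw [← Finset.inf_univ_eq_iInf, hq.inf_le'] at hle
    simpa using hle
  have hy' : y ∉ Ideal.span (g '' Set.Iio k) := fun h =>
    hq.ne_top ((Ideal.eq_top_iff_one q).2 ((hy 1).2 (by simpa using h)))
  have hlP : ∀ j < N, l i j ∈ P i := fun j hj => hl i ▸ Ideal.subset_span ⟨j, hj, rfl⟩
  obtain rfl : k = N := by
    by_contra hne
    exact hy' ((hreg i).mem_span_of_mul_mem hq.ne_top (fun j hj => hi (hlP j hj)) hg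
      (lt_of_le_of_ne hk hne) fun a ha => (hy a).1 ha)
  refine ⟨rfl, i, ?_⟩
  by_contra hne
  obtain ⟨h, hhq, hhP⟩ := SetLike.not_le_iff_exists.1 fun hqP => hne (le_antisymm hqP hi)
  have hreg' : IsRegularUpTo (Function.update (l i) k h) (k + 1) := by
    refine (hreg i).update fun x hx => ?_
    rw [hl] at hx ⊢
    exact ((hP i).mem_or_mem hx).resolve_right hhP
  refine hy' (hreg'.mem_span_of_mul_mem hq.ne_top (fun j hj => ?_) hg k.lt_succ_self
    fun a ha => (hy a).1 ha)
  rcases eq_or_ne j k with rfl | hjk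
  · simpa using hhq
  · rw [Function.update_of_ne hjk]
    exact hi (hlP j (by omega))

theorem exists_regular_generators (hP : ∀ i, (P i).IsPrime)
    (hl : ∀ i, Ideal.span (l i '' Set.Iio N) = P i) (hreg : ∀ i, IsRegularUpTo (l i) N)
    {f : ℕ → R} (hf : Ideal.span (f '' Set.Iio (N + 1)) = ⨅ i, P i)
    (hu : ∀ i, ∃ u ∉ P i, u * f N ∈ Ideal.span (f '' Set.Iio N) ⊔ P i * ⨅ i, P i)
    {k : ℕ} (hk : k ≤ N) :
    ∃ g : ℕ → R, Ideal.span (g '' Set.Iio (N + 1)) = ⨅ i, P i ∧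
      (∀ i, ∃ u ∉ P i, u * g N ∈ Ideal.span (g '' Set.Iio N) ⊔ P i * ⨅ i, P i) ∧
      IsRegularUpTo g k := by
  induction k with
  | zero => exact ⟨f, hf, hu, fun i hi => absurd hi (Nat.not_lt_zero i)⟩
  | succ k ih =>
    obtain ⟨g, hgI, hgu, hgk⟩ := ih (by omega)
    set I := ⨅ i, P i with hI
    let T := Ideal.span (g '' Set.Ioo k (N + 1))
    have hfin := associatedPrimes.finite R (R ⧸ Ideal.span (g '' Set.Iio k))
    obtain ⟨z, hz, hzq⟩ := Ideal.exists_add_forall_notMem_prime hfin.toFinset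
      (fun q hq => ((hfin.mem_toFinset).1 hq).isPrime) (I * T) (g k) (by
        intro q hq hgq hle
        rw [hfin.mem_toFinset] at hq
        obtain ⟨hqp, x, hx⟩ := isAssociatedPrime_iff.1 hq
        obtain ⟨y, rfl⟩ := Submodule.Quotient.mk_surjective _ x
        have hy : ∀ a, a ∈ q ↔ a * y ∈ Ideal.span (g '' Set.Iio k) := fun a => by
          rw [hx, Submodule.mem_colon_singleton, Submodule.mem_bot, ← Submodule.Quotient.mk_smul,
            Submodule.Quotient.mk_eq_zero, smul_eq_mul]
        have hIq : I ≤ q := by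
          refine (hqp.mul_le.1 hle).elim id fun hT => ?_
          rw [← hgI, Ideal.span_le]
          rintro _ ⟨j, hj, rfl⟩
          rcases lt_trichotomy j k with hjk | rfl | hjk
          · exact (hy _).2 (Ideal.mul_mem_right _ _ (Ideal.subset_span ⟨j, hjk, rfl⟩))
          · exact hgq
          · exact hT (Ideal.subset_span ⟨j, ⟨hjk, hj⟩, rfl⟩)
        have := (exists_eq_of_associated hP hl hreg hgk (by omega) hqp hIq hy).1
        omega)
    have hzT : z ∈ T := (Ideal.mul_le_right : I * T ≤ T) hz
    let g₁ := Function.update g k (g k + z)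
    have hg₁k : g₁ k = g k + z := by simp [g₁]
    have hg₁ : ∀ j, j ≠ k → g₁ j = g j := fun j hj => Function.update_of_ne hj _ _
    have hTg : T ≤ Ideal.span (g '' Set.Iio (N + 1)) :=
      Ideal.span_mono (Set.image_mono fun j hj => hj.2)
    have hTg' : T ≤ Ideal.span (g₁ '' Set.Iio (N + 1)) := by
      rw [Ideal.span_le]
      rintro _ ⟨j, hj, rfl⟩
      exact Ideal.subset_span ⟨j, hj.2, hg₁ j hj.1.ne'⟩
    refine ⟨g₁, ?_, fun i => ?_, hgk.update fun x hx => ?_⟩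
    · rw [← hgI]
      apply le_antisymm <;> rw [Ideal.span_le] <;> rintro _ ⟨j, hj, rfl⟩ <;>
        rcases eq_or_ne j k with rfl | hjk
      · rw [hg₁k]
        exact Ideal.add_mem _ (Ideal.subset_span ⟨j, hj, rfl⟩) (hTg hzT)
      · rw [hg₁ j hjk]
        exact Ideal.subset_span ⟨j, hj, rfl⟩
      · rw [← add_sub_cancel_right (g j) z, ← hg₁k]
        exact Ideal.sub_mem _ (Ideal.subset_span ⟨j, hj, rfl⟩) (hTg' hzT)
      · exact Ideal.subset_span ⟨j, hj, hg₁ j hjk⟩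
    · obtain ⟨u, hu, hug⟩ := hgu i
      refine ⟨u, hu, ?_⟩
      rw [hg₁ N (by omega)]
      refine (sup_le ?_ le_sup_right : _ ≤ Ideal.span (g₁ '' Set.Iio N) ⊔ P i * I) hug
      rw [Ideal.span_le]
      rintro _ ⟨j, hj, rfl⟩
      rcases eq_or_ne j k with rfl | hjk
      · rw [← add_sub_cancel_right (g j) z, ← hg₁k]
        refine Ideal.sub_mem _ (Ideal.mem_sup_left (Ideal.subset_span ⟨j, hj, rfl⟩))
          (Ideal.mem_sup_right ?_)
        exact Ideal.mul_mono (iInf_le _ _) (hTg.trans hgI.le) hz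
      · exact Ideal.mem_sup_left (Ideal.subset_span ⟨j, hj, hg₁ j hjk⟩)
    · have hsmul : IsSMulRegular (R ⧸ Ideal.span (g '' Set.Iio k)) (g k + z) := by
        by_contra hcon
        have hmem : g k + z ∈ ⋃ p ∈ associatedPrimes R (R ⧸ Ideal.span (g '' Set.Iio k)),
            (p : Set R) := by
          rw [biUnion_associatedPrimes_eq_compl_regular]
          exact hcon
        simp only [Set.mem_iUnion] at hmem
        obtain ⟨p, hp, hmem⟩ := hmem
        exact hzq p (hfin.mem_toFinset.2 hp) hmem
      exact (isSMulRegular_quotient_iff_mem_of_smul_mem _ _).1 hsmul x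
        (by simpa [mul_comm] using hx)

/-- A finite intersection of incomparable primes, each generated by a regular sequence of length
`N`, is of linear type if it is generated by `N + 1` elements. -/
theorem ker_reesMap_le_of_iInf_prime (hP : ∀ i, (P i).IsPrime)
    (hinc : ∀ i j, P i ≤ P j → i = j) (hl : ∀ i, Ideal.span (l i '' Set.Iio N) = P i)
    (hreg : ∀ i, IsRegularUpTo (l i) N) (f : Fin (N + 1) → R)
    (hf : Ideal.span (Set.range f) = ⨅ i, P i) :
    RingHom.ker (reesMap f) ≤ linearSyzygyIdeal f := by
  let f₁ : ℕ → R := fun j => if h : j < N + 1 then f ⟨j, h⟩ else 0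
  have hf₁ : Ideal.span (f₁ '' Set.Iio (N + 1)) = ⨅ i, P i := by
    rw [← hf]
    congr 1
    ext x
    constructor
    · rintro ⟨j, hj, rfl⟩
      exact ⟨⟨j, hj⟩, by simp only [f₁]; rw [dif_pos (Set.mem_Iio.1 hj)]⟩
    · rintro ⟨j, rfl⟩
      exact ⟨j, j.2, dif_pos j.2⟩
  obtain ⟨g₀, hg₀, hu₀⟩ := exists_generators_locally_span hP hinc hl hf₁
  obtain ⟨g, hg, hu, hgreg⟩ := exists_regular_generators hP hl hreg hg₀ hu₀ le_rfl
  have himage : ∀ k ≤ N + 1, (fun j : Fin (N + 1) => g j) '' {j | (j : ℕ) < k} =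
      g '' Set.Iio k := by
    intro k hk
    ext x
    constructor
    · rintro ⟨j, hj, rfl⟩
      exact ⟨j, hj, rfl⟩
    · rintro ⟨j, hj, rfl⟩
      exact ⟨⟨j, lt_of_lt_of_le hj hk⟩, hj, rfl⟩
  have hrange : Set.range (fun j : Fin (N + 1) => g j) = g '' Set.Iio (N + 1) := by
    rw [← himage _ le_rfl, ← Set.image_univ]
    congr 1
    ext j
    simpa using Nat.lt_succ_iff.1 j.2
  refine ker_reesMap_le_of_span_eq f (fun j : Fin (N + 1) => g j) (by rw [hrange, hg, hf])
    (ker_reesMap_le_of_colon _ fun i x hx hxi => ?_)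
  have hi : (fun j : Fin (N + 1) => g j) '' {j | j < i} = g '' Set.Iio (i : ℕ) :=
    himage i i.2.le
  rw [hrange, hg] at hx
  rw [hi] at hxi ⊢
  rcases (Nat.lt_succ_iff_lt_or_eq.1 i.2) with hiN | hiN
  · exact hgreg i hiN x hxi
  rw [hiN] at hxi ⊢
  set J := Ideal.span (g '' Set.Iio N) with hJ
  by_contra hxJ
  obtain ⟨q, hq, hxq⟩ := exists_le_isAssociatedPrime_of_isNoetherianRing R
    (Submodule.Quotient.mk x : R ⧸ J) (by rwa [Ne, Submodule.Quotient.mk_eq_zero])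
  have hmem : ∀ a, a * x ∈ J → a ∈ q := fun a ha => hxq (by
    rwa [Submodule.mem_colon_singleton, Submodule.mem_bot, ← Submodule.Quotient.mk_smul,
            Submodule.Quotient.mk_eq_zero, smul_eq_mul])
  obtain ⟨hqp, w, hw⟩ := isAssociatedPrime_iff.1 hq
  obtain ⟨y, rfl⟩ := Submodule.Quotient.mk_surjective _ w
  have hy : ∀ a, a ∈ q ↔ a * y ∈ J := fun a => by
    rw [hw, Submodule.mem_colon_singleton, Submodule.mem_bot, ← Submodule.Quotient.mk_smul,
      Submodule.Quotient.mk_eq_zero, smul_eq_mul]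
  have hsplit : ⨅ i, P i = J ⊔ Ideal.span {g N} := by
    rw [← hg, hJ, ← Ideal.span_union, ← Set.image_singleton, ← Set.image_union]
    congr 2
    ext j
    simp [le_iff_eq_or_lt]
  have hle : ⨅ i, P i ≤ q := by
    rw [hsplit]
    refine sup_le (fun a ha => hmem a (Ideal.mul_mem_right _ _ ha)) ?_
    rw [Ideal.span_singleton_le_iff_mem]
    exact hmem _ (by rw [mul_comm]; exact hiN ▸ hxi)
  obtain ⟨-, i', rfl⟩ := exists_eq_of_associated hP hl hreg hgreg le_rfl hqp hle hy
  obtain ⟨u, hu, hug⟩ := hu i'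
  have hPI : J ⊔ P i' * ⨅ i, P i ≤ J ⊔ Ideal.span {g N} * P i' := by
    refine sup_le le_sup_left ?_
    rw [hsplit, Ideal.mul_sup, mul_comm (P i') (Ideal.span {g N})]
    exact sup_le_sup_right Ideal.mul_le_right _
  obtain ⟨a, ha, b, hb, hab⟩ := Submodule.mem_sup.1 (hPI hug)
  obtain ⟨p, hp, rfl⟩ := Ideal.mem_span_singleton_mul.1 hb
  have hupJ : (u - p) * g N ∈ J := by
    have : (u - p) * g N = a := by rw [sub_mul, ← hab]; ring
    rwa [this]
  have hup : u - p ∉ P i' := by rwa [Submodule.sub_mem_iff_left _ hp]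
  refine hup (hmem _ ?_)
  rw [hsplit] at hx
  obtain ⟨a, ha, b, hb, rfl⟩ := Submodule.mem_sup.1 hx
  obtain ⟨r, rfl⟩ := Ideal.mem_span_singleton'.1 hb
  rw [mul_add, mul_left_comm]
  exact Ideal.add_mem _ (Ideal.mul_mem_left _ _ ha) (Ideal.mul_mem_left _ _ hupJ)

end IntersectionOfPrimes

section PointIdeals

/-- The substitution `x_k ↦ c_k x_{i₀}` for `k ∈ S`. -/
def collapse {σ R : Type*} [CommRing R] (c : σ → R) (i₀ : σ) (S : Set σ) :
    MvPolynomial σ R →ₐ[R] MvPolynomial σ R :=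
  open Classical in aeval fun k => if k ∈ S then C (c k) * X i₀ else X k

theorem ker_collapse {σ R : Type*} [CommRing R] (c : σ → R) {i₀ : σ} {S : Set σ} (hi₀ : i₀ ∉ S) :
    RingHom.ker (collapse c i₀ S) =
      Ideal.span ((fun k => X k - C (c k) * X i₀) '' S) := by
  set I : Ideal (MvPolynomial σ R) := Ideal.span ((fun k => X k - C (c k) * X i₀) '' S)
  have hcomp : (Ideal.Quotient.mkₐ R I).comp (collapse c i₀ S) = Ideal.Quotient.mkₐ R I := by
    ext1 k
    simp only [AlgHom.comp_apply, collapse, aeval_X]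
    split_ifs with hk
    · simp only [Ideal.Quotient.mkₐ_eq_mk]
      exact (Ideal.Quotient.mk_eq_mk_iff_sub_mem _ _).2
        (by simpa using I.neg_mem (Ideal.subset_span ⟨k, hk, rfl⟩))
    · rfl
  apply le_antisymm
  · intro F hF
    have := AlgHom.congr_fun hcomp F
    rw [AlgHom.comp_apply, RingHom.mem_ker.1 hF, map_zero] at this
    exact Ideal.Quotient.eq_zero_iff_mem.1 this.symm
  · rw [Ideal.span_le]
    rintro _ ⟨k, hk, rfl⟩
    simp [collapse, RingHom.mem_ker, hk, hi₀]

variable {K : Type*} [Field K]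

theorem pointIdeal_eq_ker {n : ℕ} (v : Fin n → K) :
    pointIdeal v = RingHom.ker (reesMap v) := by
  apply le_antisymm
  · refine Ideal.span_le.2 fun F => ?_
    rintro ⟨⟨d, hd⟩, hF⟩
    rw [SetLike.mem_coe, RingHom.mem_ker, reesMap_of_isHomogeneous v hd, aeval_eq_eval,
      hF, map_zero, zero_mul]
  · intro F hF
    rw [mem_ker_reesMap_iff] at hF
    rw [← sum_homogeneousComponent F]
    exact Ideal.sum_mem _ fun d _ => Ideal.subset_span
      ⟨⟨d, homogeneousComponent_isHomogeneous _ _⟩, hF d⟩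

theorem pointIdeal_isPrime {n : ℕ} (v : Fin n → K) : (pointIdeal v).IsPrime := by
  rw [pointIdeal_eq_ker]
  exact RingHom.ker_isPrime _

theorem sub_mem_pointIdeal {n : ℕ} (v : Fin n → K) {i₀ : Fin n} (hi₀ : v i₀ ≠ 0) (k : Fin n) :
    X k - C (v k / v i₀) * X i₀ ∈ pointIdeal v :=
  Ideal.subset_span ⟨⟨1, (isHomogeneous_X _ _).sub (isHomogeneous_C_mul_X _ _)⟩, by
    simp [div_mul_cancel₀ _ hi₀]⟩

theorem pointIdeal_eq_span {n : ℕ} (v : Fin n → K) {i₀ : Fin n} (hi₀ : v i₀ ≠ 0) :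
    pointIdeal v = Ideal.span ((fun k => X k - C (v k / v i₀) * X i₀) '' {i₀}ᶜ) := by
  apply le_antisymm
  · rw [pointIdeal_eq_ker, ← ker_collapse _ (by simp)]
    let ρ : Polynomial K →ₐ[K] MvPolynomial (Fin n) K := Polynomial.aeval (C (v i₀)⁻¹ * X i₀)
    have hρ : ρ.comp (reesMap v) = collapse (fun k => v k / v i₀) i₀ {i₀}ᶜ := by
      ext1 k
      have hCC : ∀ a, C a * (C (v i₀)⁻¹ * X i₀) = (C (a * (v i₀)⁻¹) * X i₀ : MvPolynomial _ K) :=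
        fun a => by rw [C_mul, mul_assoc]
      by_cases hk : k = i₀
      · subst hk
        simp [ρ, reesMap, collapse, Polynomial.aeval_C, algebraMap_eq, hCC]
        rw [← C_mul, mul_inv_cancel₀ hi₀, C_1]
      · simp [ρ, reesMap, collapse, Polynomial.aeval_C, algebraMap_eq, hk, hCC, div_eq_mul_inv]
    intro F hF
    rw [RingHom.mem_ker, ← hρ, AlgHom.comp_apply, RingHom.mem_ker.1 hF, map_zero]
  · rw [Ideal.span_le]
    rintro _ ⟨k, -, rfl⟩
    exact sub_mem_pointIdeal v hi₀ k

theorem eq_smul_of_pointIdeal_le {n : ℕ} {v w : Fin n → K} (hv : v ≠ 0)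
    (h : pointIdeal v ≤ pointIdeal w) : ∃ t : K, w = t • v := by
  obtain ⟨i₀, hi₀⟩ := Function.ne_iff.1 hv
  refine ⟨w i₀ / v i₀, funext fun k => ?_⟩
  have hk := h (sub_mem_pointIdeal v hi₀ k)
  rw [pointIdeal_eq_ker, mem_ker_reesMap_iff] at hk
  have := hk 1
  rw [homogeneousComponent_eq_self ((isHomogeneous_X _ _).sub (isHomogeneous_C_mul_X _ _))] at this
  simp only [map_sub, map_mul, aeval_X, algHom_C, sub_eq_zero] at this
  rw [this, Pi.smul_apply, smul_eq_mul, Algebra.algebraMap_self_apply]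
  ring

/-- The ideal of a point in `N`-space is generated by a regular sequence of `N` linear forms. -/
theorem exists_isRegularUpTo_span_eq_pointIdeal {N : ℕ} {v : Fin (N + 1) → K} (hv : v ≠ 0) :
    ∃ l : ℕ → MvPolynomial (Fin (N + 1)) K,
      Ideal.span (l '' Set.Iio N) = pointIdeal v ∧ IsRegularUpTo l N := by
  obtain ⟨i₀, hi₀⟩ := Function.ne_iff.1 hv
  let e : ℕ → Fin (N + 1) := fun k => if h : k < N then i₀.succAbove ⟨k, h⟩ else i₀
  have he : ∀ k (h : k < N), e k = i₀.succAbove ⟨k, h⟩ := fun k h => dif_pos h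
  have hne : ∀ k < N, e k ≠ i₀ := fun k h => he k h ▸ Fin.succAbove_ne _ _
  have hinj : ∀ j < N, ∀ k < N, e j = e k → j = k := fun j hj k hk h => by
    rw [he j hj, he k hk] at h
    simpa using Fin.succAbove_right_injective h
  have himage : e '' Set.Iio N = {i₀}ᶜ := by
    ext x
    constructor
    · rintro ⟨k, hk, rfl⟩
      exact hne k hk
    · intro hx
      obtain ⟨k, rfl⟩ := Fin.exists_succAbove_eq hx
      exact ⟨k, k.2, he k k.2⟩
  let lin : Fin (N + 1) → MvPolynomial (Fin (N + 1)) K := fun k => X k - C (v k / v i₀) * X i₀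
  refine ⟨lin ∘ e, by rw [Set.image_comp, himage, pointIdeal_eq_span v hi₀], ?_⟩
  intro i hi x hx
  have hi₀' : i₀ ∉ e '' Set.Iio i := by
    rintro ⟨k, hk, hke⟩
    exact hne k (lt_trans hk hi) hke
  rw [Set.image_comp, ← ker_collapse _ hi₀'] at hx ⊢
  refine ((RingHom.ker_isPrime _).mem_or_mem hx).resolve_right fun h => ?_
  have hei : e i ∉ e '' Set.Iio i := by
    rintro ⟨k, hk, hke⟩
    exact hk.ne (hinj k (lt_trans hk hi) i hi hke)
  have h0 : (X (e i) - C (v (e i) / v i₀) * X i₀ : MvPolynomial (Fin (N + 1)) K) = 0 := by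
    rw [RingHom.mem_ker] at h
    simpa only [Function.comp_apply, lin, collapse, map_sub, map_mul, aeval_X, algHom_C,
      algebraMap_eq, if_neg hei, if_neg hi₀'] using h
  have := congrArg (eval (Pi.single (e i) (1 : K))) h0
  simp [Pi.single_eq_of_ne (hne i hi).symm] at this

end PointIdeals

/-- a strict almost complete intersection ideal `I ⊆ K[x₀,…,x_N]`
defining a reduced set of points in `Pᴺ`, with minimal generators
`f₁,…,f_{N+1}`, is of linear type: the kernel of the `R`-algebra map
`R[T₁,…,T_{N+1}] → R[t]`, `Tᵢ ↦ fᵢ·t`, is generated by its elements that are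
homogeneous of degree 1 in the `Tᵢ`. -/
theorem points_aci_linear_type {K : Type*} [Field K] {N : ℕ}
    (I : Ideal (MvPolynomial (Fin (N + 1)) K))
    (f : Fin (N + 1) → MvPolynomial (Fin (N + 1)) K)
    (hpts : DefinesReducedPoints I)
    (hgen : I = Ideal.span (Set.range f))
    (hmin : ∀ i, f i ∉ Ideal.span (f '' {j | j ≠ i})) :
    let R := MvPolynomial (Fin (N + 1)) K
    let φ : MvPolynomial (Fin (N + 1)) R →ₐ[R] Polynomial R :=
      aeval fun i => Polynomial.C (f i) * Polynomial.X
    RingHom.ker φ =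
      Ideal.span {F | F ∈ RingHom.ker φ ∧ F.IsHomogeneous 1} := by
  intro R φ
  obtain ⟨n, p, hp, hpp, hI⟩ := hpts
  choose l hl hreg using fun i => exists_isRegularUpTo_span_eq_pointIdeal (hp i)
  refine le_antisymm (ker_reesMap_le_of_iInf_prime (fun i => pointIdeal_isPrime (p i))
    (fun i j hij => ?_) hl hreg f (hgen.symm.trans hI)) (linearSyzygyIdeal_le_ker f)
  by_contra hne
  obtain ⟨t, ht⟩ := eq_smul_of_pointIdeal_le (hp i) hij
  exact hpp j i (Ne.symm hne) t ht

end
end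

section
/- Let K be a field, R = K[x,y,z], and let I = (f,g,h) be a strict almost complete intersection ideal defining a reduced set of points in P^2, with (P_1,P_2,P_3) and (Q_1,Q_2,Q_3) the two columns of a Hilbert–Burch matrix of I (i.e., generators of the syzygy module of (f,g,h)). Set S = R[T_1,T_2,T_3], F = P_1T_1 + P_2T_2 + P_3T_3 and G = Q_1T_1 + Q_2T_2 + Q_3T_3. Then the kernel of the R-algebra homomorphism S → R[t] sending T_i to (f,g,h)_i · t equals the ideal (F, G), and this ideal is a complete intersection: it has height 2 and is generated by the two elements F, G. In particular the Rees algebra and the symmetric algebra of I both equal S/(F,G). -/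
open MvPolynomial

noncomputable section

/-- The height of an ideal: the infimum of the heights of the primes containing it. -/
def idealHeight {S : Type*} [CommRing S] (J : Ideal S) : ℕ∞ :=
  ⨅ P ∈ {P : PrimeSpectrum S | J ≤ P.asIdeal}, Order.height P

section LinearForms

variable {R : Type*} [CommRing R]

/-- The linear form `∑ vᵢ Tᵢ` with coefficient vector `v`. -/
def linForm (v : Fin 3 → R) : MvPolynomial (Fin 3) R := ∑ i, C (v i) * X i

/-- The maximal minors of the `2 × 3` matrix with rows `P` and `Q`, up to sign and order. -/
def minors (P Q : Fin 3 → R) (i : Fin 3) : R :=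
  P (i + 1) * Q (i + 2) - P (i + 2) * Q (i + 1)

theorem sum_fin_three_cyclic {M : Type*} [AddCommMonoid M] (g : Fin 3 → M) (i : Fin 3) :
    ∑ j, g j = g i + g (i + 1) + g (i + 2) := by
  fin_cases i
  · simp [Fin.sum_univ_three]
  · simp only [Fin.sum_univ_three, Fin.mk_one, Fin.reduceAdd]
    abel
  · simp only [Fin.sum_univ_three, Fin.reduceFinMk, Fin.reduceAdd]
    abel

theorem coeff_linForm (v : Fin 3 → R) (i : Fin 3) :
    coeff (Finsupp.single i 1) (linForm v) = v i := by
  classical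
  simp [linForm, coeff_sum, coeff_C_mul, coeff_X, Finsupp.single_left_inj]

theorem linForm_injective : Function.Injective (linForm (R := R)) := fun v w h =>
  funext fun i => by rw [← coeff_linForm v, h, coeff_linForm]

theorem C_mul_linForm (a : R) (v : Fin 3 → R) : C a * linForm v = linForm (a • v) := by
  simp [linForm, Finset.mul_sum, mul_assoc]

theorem linForm_add (v w : Fin 3 → R) : linForm (v + w) = linForm v + linForm w := by
  simp [linForm, add_mul, Finset.sum_add_distrib]

theorem linForm_zero : linForm (0 : Fin 3 → R) = 0 := by
  simp [linForm]

theorem isHomogeneous_linForm (v : Fin 3 → R) : (linForm v).IsHomogeneous 1 :=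
  IsHomogeneous.sum _ _ _ fun i _ => by
    simpa using (isHomogeneous_C _ (v i)).mul (isHomogeneous_X R i)

theorem aeval_linForm {A : Type*} [CommRing A] [Algebra R A] (g : Fin 3 → A) (v : Fin 3 → R) :
    aeval g (linForm v) = ∑ i, algebraMap R A (v i) * g i := by
  simp [linForm]

theorem aeval_mul_left_of_isHomogeneous {σ A : Type*} [CommRing A] [Algebra R A]
    {s : MvPolynomial σ R} {d : ℕ} (hs : s.IsHomogeneous d) (c : A) (g : σ → A) :
    aeval (fun i => c * g i) s = c ^ d * aeval g s := by
  rw [aeval_def, aeval_def, eval₂_eq, eval₂_eq, Finset.mul_sum]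
  refine Finset.sum_congr rfl fun m hm => ?_
  have hd : ∑ i ∈ m.support, m i = d := by
    have := hs (mem_support_iff.1 hm)
    rwa [Finsupp.weight_apply, Finsupp.sum, Finset.sum_congr rfl (g := fun i => m i)
      (fun i _ => by simp)] at this
  simp only [mul_pow, Finset.prod_mul_distrib, Finset.prod_pow_eq_pow_sum, hd]
  ring

theorem aeval_sub_mem_of_isHomogeneous {σ : Type*} {J : Ideal (MvPolynomial σ R)}
    {s : MvPolynomial σ R} {d : ℕ} (hs : s.IsHomogeneous d) (c : R) (g : σ → MvPolynomial σ R)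
    (hg : ∀ i, g i - C c * X i ∈ J) : aeval g s - C c ^ d * s ∈ J := by
  rw [← Ideal.Quotient.mk_eq_mk_iff_sub_mem]
  have h1 : ∀ g' : σ → MvPolynomial σ R, Ideal.Quotient.mk J (aeval g' s) =
      aeval (fun i => Ideal.Quotient.mk J (g' i)) s := fun g' =>
    (DFunLike.congr_fun (comp_aeval g' (Ideal.Quotient.mkₐ R J)) s)
  have h2 : C c ^ d * s = aeval (fun i => C c * X i) s := by
    rw [aeval_mul_left_of_isHomogeneous hs (C c) X, aeval_X_left_apply]
  rw [h2, h1, h1]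
  congr 2
  funext i
  exact (Ideal.Quotient.mk_eq_mk_iff_sub_mem _ _).2 (hg i)

variable [IsDomain R]

theorem linForm_isRelPrime {P Q : Fin 3 → R}
    (hrel : ∀ c, (∀ i, c ∣ minors P Q i) → IsUnit c) : IsRelPrime (linForm P) (linForm Q) := by
  have hne : ∃ i, minors P Q i ≠ 0 := by
    by_contra! h
    exact not_isUnit_zero (hrel 0 fun i => by rw [h i])
  obtain ⟨i, hi⟩ := hne
  have hP : linForm P ≠ 0 := by
    intro h
    have : P = 0 := linForm_injective (h.trans linForm_zero.symm)
    simp [minors, this] at hi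
  have hQ : linForm Q ≠ 0 := by
    intro h
    have : Q = 0 := linForm_injective (h.trans linForm_zero.symm)
    simp [minors, this] at hi
  rintro d ⟨a, ha⟩ ⟨b, hb⟩
  have hd : d ≠ 0 := by rintro rfl; simp [hP] at ha
  have ha0 : a ≠ 0 := by rintro rfl; simp [hP] at ha
  have hb0 : b ≠ 0 := by rintro rfl; simp [hQ] at hb
  have hda := totalDegree_mul_of_isDomain hd ha0
  have hdb := totalDegree_mul_of_isDomain hd hb0
  rw [← ha, (isHomogeneous_linForm P).totalDegree hP] at hda
  rw [← hb, (isHomogeneous_linForm Q).totalDegree hQ] at hdb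
  by_cases h0 : d.totalDegree = 0
  · rw [totalDegree_eq_zero_iff_eq_C] at h0
    rw [h0]
    refine IsUnit.map C (hrel _ fun j => ?_)
    have hPd : ∀ k, coeff 0 d ∣ P k := fun k => by
      rw [← coeff_linForm P]
      exact (C_dvd_iff_dvd_coeff _ _).1 ⟨a, by rw [← h0, ha]⟩ _
    exact dvd_sub ((hPd _).mul_right _) ((hPd _).mul_right _)
  · have ha1 : a.totalDegree = 0 := by omega
    have hb1 : b.totalDegree = 0 := by omega
    rw [totalDegree_eq_zero_iff_eq_C] at ha1 hb1
    have key : coeff 0 b • P = coeff 0 a • Q := by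
      apply linForm_injective
      rw [← C_mul_linForm, ← C_mul_linForm, ← ha1, ← hb1, ha, hb]
      ring
    have hk : ∀ k, coeff 0 b * P k = coeff 0 a * Q k := fun k => congrFun key k
    have : coeff 0 b * minors P Q i = 0 := by
      simp only [minors]
      linear_combination Q (i + 2) * hk (i + 1) - Q (i + 1) * hk (i + 2)
    rcases mul_eq_zero.1 this with h | h
    · rw [h, C_0] at hb1
      exact absurd hb1 hb0
    · exact absurd h hi

theorem irreducible_linForm {v : Fin 3 → R} (h0 : v ≠ 0)
    (hv : ∀ c, (∀ i, c ∣ v i) → IsUnit c) : Irreducible (linForm v) := by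
  have hl : linForm v ≠ 0 := fun h => h0 (linForm_injective (h.trans linForm_zero.symm))
  refine irreducible_of_totalDegree_eq_one ((isHomogeneous_linForm v).totalDegree hl) ?_
  intro c hc
  exact hv c fun i => by rw [← coeff_linForm v]; exact hc _

theorem mem_of_X_mul_mem {K : Type*} [Field K] {F G s : MvPolynomial (Fin 3) (MvPolynomial (Fin 3) K)}
    (hrel : IsRelPrime F G) (hG : G ≠ 0)
    (hs : ∀ i : Fin 3, C (X i) * s ∈ Ideal.span {F, G}) : s ∈ Ideal.span {F, G} := by
  have hsub : ∀ u v : MvPolynomial (Fin 3) (MvPolynomial (Fin 3) K), u * F = v * G → G ∣ u :=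
    fun u v h => hrel.symm.dvd_of_dvd_mul_right ⟨v, by rw [h, mul_comm]⟩
  obtain ⟨u, v, h0⟩ := Ideal.mem_span_pair.1 (hs 0)
  obtain ⟨u', v', h1⟩ := Ideal.mem_span_pair.1 (hs 1)
  obtain ⟨u'', v'', h2⟩ := Ideal.mem_span_pair.1 (hs 2)
  set a : MvPolynomial (Fin 3) (MvPolynomial (Fin 3) K) := C (X 0) with ha
  set b : MvPolynomial (Fin 3) (MvPolynomial (Fin 3) K) := C (X 1) with hb
  set c : MvPolynomial (Fin 3) (MvPolynomial (Fin 3) K) := C (X 2) with hc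
  obtain ⟨w, hw⟩ := hsub (b * u - a * u') (a * v' - b * v) (by linear_combination b * h0 - a * h1)
  obtain ⟨w', hw'⟩ := hsub (c * u - a * u'') (a * v'' - c * v)
    (by linear_combination c * h0 - a * h2)
  obtain ⟨w'', hw''⟩ := hsub (c * u' - b * u'') (b * v'' - c * v')
    (by linear_combination c * h1 - b * h2)
  have hcw : c * w = b * w' - a * w'' := by
    apply mul_left_cancel₀ hG
    linear_combination b * hw' - c * hw - a * hw''
  have hmem : c * w ∈ Ideal.map C (Ideal.span (X '' {0, 1} : Set (MvPolynomial (Fin 3) K))) := by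
    rw [hcw]
    refine sub_mem (Ideal.mul_mem_right _ _ (Ideal.mem_map_of_mem _ (Ideal.subset_span ?_)))
      (Ideal.mul_mem_right _ _ (Ideal.mem_map_of_mem _ (Ideal.subset_span ?_)))
    · exact ⟨1, by simp, rfl⟩
    · exact ⟨0, by simp, rfl⟩
  have hwmem : w ∈ Ideal.map C (Ideal.span (X '' {0, 1} : Set (MvPolynomial (Fin 3) K))) := by
    rw [mem_map_C_iff] at hmem ⊢
    intro m
    have := hmem m
    rw [hc, coeff_C_mul, mem_ideal_span_X_image] at this
    rw [mem_ideal_span_X_image]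
    intro n hn
    obtain ⟨i, hi, hne⟩ := this (Finsupp.single 2 1 + n) (by
      rw [mem_support_iff, coeff_X_mul]; exact mem_support_iff.1 hn)
    refine ⟨i, hi, ?_⟩
    rcases hi with rfl | rfl <;> simpa using hne
  rw [Ideal.map_span, Set.image_pair, Set.image_pair, Ideal.mem_span_pair] at hwmem
  obtain ⟨α, β, hαβ⟩ := hwmem
  have hab : ∀ t t', b * t = a * t' → a ∣ t := fun t t' h => by
    have hp : Prime a := (prime_C_iff (Fin 3)).2 (X_prime (σ := Fin 3) (R := K) (i := 0))
    refine (hp.dvd_or_dvd ⟨t', h⟩).resolve_left fun hd => ?_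
    have := (C_dvd_iff_dvd_coeff _ _).1 hd 0
    rw [hb, coeff_zero_C, X_dvd_X] at this
    simp at this
  obtain ⟨t, ht⟩ := hab (u - β * G) (u' + α * G) (by linear_combination hw - G * hαβ)
  have hv : b * v - a * v' = - (w * F) := by
    apply mul_left_cancel₀ hG
    linear_combination b * h0 - a * h1 - F * hw
  obtain ⟨t', ht'⟩ := hab (v + β * F) (v' - α * F) (by linear_combination hv + F * hαβ)
  refine Ideal.mem_span_pair.2 ⟨t, t', ?_⟩
  have ha0 : a ≠ 0 := by simp [ha]
  apply mul_left_cancel₀ ha0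
  linear_combination h0 - F * ht - G * ht'

end LinearForms

section HilbertBurch

variable {R : Type*} [CommRing R] [UniqueFactorizationMonoid R]

theorem exists_reduced_factors_of_or_ne_zero {a b : R} (h : a ≠ 0 ∨ b ≠ 0) :
    ∃ a' b' c, IsRelPrime a' b' ∧ c * a' = a ∧ c * b' = b := by
  rcases h with h | h
  · exact UniqueFactorizationMonoid.exists_reduced_factors a h b
  · obtain ⟨b', a', c, hr, hb, ha⟩ := UniqueFactorizationMonoid.exists_reduced_factors b h a
    exact ⟨a', b', c, hr.symm, ha, hb⟩

variable [IsDomain R]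

theorem dvd_of_forall_dvd_mul {ι : Type*} {f : ι → R} (hf : ∀ c, (∀ i, c ∣ f i) → IsUnit c)
    {a x : R} (ha : a ≠ 0) (h : ∀ i, a ∣ x * f i) : a ∣ x := by
  obtain ⟨a', x', c, hrel, rfl, rfl⟩ := UniqueFactorizationMonoid.exists_reduced_factors a ha x
  have hc : c ≠ 0 := left_ne_zero_of_mul ha
  refine mul_dvd_mul_left c (hf a' fun i => ?_).dvd
  have := h i
  rw [mul_assoc, mul_dvd_mul_iff_left hc] at this
  exact hrel.dvd_of_dvd_mul_left this

theorem exists_isUnit_minors_eq {f P Q : Fin 3 → R} (hf0 : ∀ i, f i ≠ 0)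
    (hf : ∀ c, (∀ i, c ∣ f i) → IsUnit c)
    (hsyz : ∀ v : Fin 3 → R, (∑ i, v i * f i = 0) ↔ v ∈ Submodule.span R {P, Q}) :
    ∃ u, IsUnit u ∧ ∀ i, minors P Q i = u * f i := by
  have hP : ∑ i, P i * f i = 0 := (hsyz P).2 (Submodule.subset_span (by simp))
  have hQ : ∑ i, Q i * f i = 0 := (hsyz Q).2 (Submodule.subset_span (by simp))
  have hpar : ∀ i j, f i * minors P Q j = f j * minors P Q i := by
    rw [Fin.sum_univ_three] at hP hQ
    have h01 : f 0 * minors P Q 1 = f 1 * minors P Q 0 := by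
      simp only [minors, Fin.isValue, Fin.reduceAdd, zero_add]
      linear_combination P 2 * hQ - Q 2 * hP
    have h12 : f 1 * minors P Q 2 = f 2 * minors P Q 1 := by
      simp only [minors, Fin.isValue, Fin.reduceAdd]
      linear_combination P 0 * hQ - Q 0 * hP
    have h02 : f 0 * minors P Q 2 = f 2 * minors P Q 0 := by
      simp only [minors, Fin.isValue, Fin.reduceAdd, zero_add]
      linear_combination -P 1 * hQ + Q 1 * hP
    intro i j
    fin_cases i <;> fin_cases j <;> simp [h01, h12, h02]
  have hsq : ∀ i, ∃ δ, ∀ j, f i * f j = δ * minors P Q j := by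
    have key : ∀ a b : Fin 3 → R, ∑ i, a i * f i = 0 → ∑ i, b i * f i = 0 →
        ∃ δ, ∀ j, minors a b j = δ * minors P Q j := by
      intro a b ha hb
      obtain ⟨α, β, rfl⟩ := Submodule.mem_span_pair.1 ((hsyz a).1 ha)
      obtain ⟨γ, ε, rfl⟩ := Submodule.mem_span_pair.1 ((hsyz b).1 hb)
      refine ⟨α * ε - β * γ, fun j => ?_⟩
      simp only [minors, Pi.add_apply, Pi.smul_apply, smul_eq_mul]
      ring
    intro i
    fin_cases i
    · obtain ⟨δ, h⟩ := key ![f 2, 0, -f 0] ![-f 1, f 0, 0]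
        (by simp [Fin.sum_univ_three]; ring) (by simp [Fin.sum_univ_three]; ring)
      refine ⟨δ, fun j => (Eq.trans ?_ (h j))⟩
      fin_cases j <;> simp [minors]
      ring
    · obtain ⟨δ, h⟩ := key ![-f 1, f 0, 0] ![0, -f 2, f 1]
        (by simp [Fin.sum_univ_three]; ring) (by simp [Fin.sum_univ_three]; ring)
      refine ⟨δ, fun j => (Eq.trans ?_ (h j))⟩
      fin_cases j <;> simp [minors]
      ring
    · obtain ⟨δ, h⟩ := key ![0, -f 2, f 1] ![f 2, 0, -f 0]
        (by simp [Fin.sum_univ_three]; ring) (by simp [Fin.sum_univ_three]; ring)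
      refine ⟨δ, fun j => (Eq.trans ?_ (h j))⟩
      fin_cases j <;> simp [minors]
      ring
  obtain ⟨u, hu⟩ : f 0 ∣ minors P Q 0 :=
    dvd_of_forall_dvd_mul hf (hf0 0) fun j => ⟨minors P Q j, by rw [hpar 0 j, mul_comm]⟩
  refine ⟨u, hf u fun i => ?_, fun i => ?_⟩
  · obtain ⟨δ, hδ⟩ := hsq i
    refine ⟨δ, mul_right_cancel₀ (hf0 0) ?_⟩
    rw [hδ 0, hu]
    ring
  · apply mul_left_cancel₀ (hf0 0)
    rw [hpar 0 i, hu]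
    ring

theorem C_pow_mul_mem_of_aeval_eq_zero {A : Type*} [CommRing A] {f P Q : Fin 3 → A}
    (hsyz : ∀ v : Fin 3 → A, (∑ i, v i * f i = 0) ↔ v ∈ Submodule.span A {P, Q})
    {s : MvPolynomial (Fin 3) A} {d : ℕ} (hs : s.IsHomogeneous d) (h0 : aeval f s = 0)
    (k : Fin 3) : C (f k) ^ d * s ∈ Ideal.span {linForm P, linForm Q} := by
  have h := aeval_sub_mem_of_isHomogeneous (J := Ideal.span {linForm P, linForm Q}) hs (f k)
    (fun j => X k * algebraMap A _ (f j)) (fun j => by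
      have hv : ∑ i, (f j • Pi.single k 1 - f k • Pi.single j 1 : Fin 3 → A) i * f i = 0 := by
        simp [sub_mul, Finset.sum_sub_distrib, Pi.single_apply]
        ring
      obtain ⟨α, β, hαβ⟩ := Submodule.mem_span_pair.1 ((hsyz _).1 hv)
      refine Ideal.mem_span_pair.2 ⟨C α, C β, ?_⟩
      rw [C_mul_linForm, C_mul_linForm, ← linForm_add, hαβ]
      simp [linForm, Pi.single_apply, sub_mul, Finset.sum_sub_distrib, algebraMap_eq,
        apply_ite (C (σ := Fin 3)), ite_mul]
      ring)
  have h1 : aeval (fun j => algebraMap A (MvPolynomial (Fin 3) A) (f j)) s = 0 := by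
    have := aeval_algebraMap_apply (MvPolynomial (Fin 3) A) f s
    rwa [h0, map_zero] at this
  rw [aeval_mul_left_of_isHomogeneous hs, h1, mul_zero,
    zero_sub, neg_mem_iff] at h
  exact h

theorem C_entry_pow_mul_mem {f P Q : Fin 3 → R} (hf0 : ∃ i, f i ≠ 0)
    (hsyz : ∀ v : Fin 3 → R, (∑ i, v i * f i = 0) ↔ v ∈ Submodule.span R {P, Q})
    (hrel : ∀ c, (∀ i, c ∣ minors P Q i) → IsUnit c)
    {s : MvPolynomial (Fin 3) R} {d : ℕ} (hs : s.IsHomogeneous d) (h0 : aeval f s = 0)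
    (i : Fin 3) : C (P i) ^ (d + 1) * s ∈ Ideal.span {linForm P, linForm Q} := by
  rcases eq_or_ne (P i) 0 with he | he
  · simp [he]
  have hi1 : i + 1 ≠ i := by simp
  have hi2 : i + 2 ≠ i := by simp
  have hi12 : i + 2 ≠ i + 1 := by simp
  have hi3 : i + 2 + 1 = i := by fin_cases i <;> rfl
  have hi4 : i + 2 + 2 = i + 1 := by fin_cases i <;> rfl
  have hi5 : i + 1 + 2 = i := by fin_cases i <;> rfl
  have hi6 : i + 1 + 1 = i + 2 := by fin_cases i <;> rfl
  have hF : linForm P = C (P i) * X i + C (P (i + 1)) * X (i + 1) + C (P (i + 2)) * X (i + 2) :=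
    sum_fin_three_cyclic _ i
  have hG : linForm Q = C (Q i) * X i + C (Q (i + 1)) * X (i + 1) + C (Q (i + 2)) * X (i + 2) :=
    sum_fin_three_cyclic _ i
  have hFJ : linForm P ∈ Ideal.span {linForm P, linForm Q} := Ideal.subset_span (by simp)
  have hGJ : linForm Q ∈ Ideal.span {linForm P, linForm Q} := Ideal.subset_span (by simp)
  -- eliminate the variable `X i` by means of `linForm P`
  let g : Fin 3 → MvPolynomial (Fin 3) R := fun j => 
    C (P i) * X j - (Pi.single i (linForm P) : Fin 3 → MvPolynomial (Fin 3) R) j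
  have hgJ : aeval g s - C (P i) ^ d * s ∈ Ideal.span {linForm P, linForm Q} := by
    refine aeval_sub_mem_of_isHomogeneous hs (P i) g fun j => ?_
    rcases eq_or_ne j i with rfl | hj
    · simpa [g] using hFJ
    · simp [g, Pi.single_eq_of_ne hj]
  have hgi : g i = C (P i) * X i - linForm P := by simp [g]
  have hg1 : g (i + 1) = C (P i) * X (i + 1) := by simp [g]
  have hg2 : g (i + 2) = C (P i) * X (i + 2) := by simp [g]
  have hgF : aeval g (linForm P) = 0 := by
    rw [aeval_linForm, sum_fin_three_cyclic _ i, hgi, hg1, hg2, algebraMap_eq]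
    linear_combination (-C (P i)) * hF
  have hgG : aeval g (linForm Q) = C (P i) * linForm Q - C (Q i) * linForm P := by
    rw [aeval_linForm, sum_fin_three_cyclic _ i, hgi, hg1, hg2, algebraMap_eq]
    linear_combination (-C (P i)) * hG
  have hm : ∑ j, P j * minors P Q j = 0 := by
    rw [Fin.sum_univ_three]
    simp only [minors, Fin.isValue, Fin.reduceAdd, zero_add]
    ring
  rw [sum_fin_three_cyclic _ i] at hm
  have hall : ∀ c, c ∣ minors P Q i → c ∣ minors P Q (i + 1) → c ∣ minors P Q (i + 2) →
      IsUnit c := by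
    intro c h1 h2 h3
    refine hrel c fun j => ?_
    have : j = i ∨ j = i + 1 ∨ j = i + 2 := by
      clear * -
      revert i j
      decide
    rcases this with rfl | rfl | rfl <;> assumption
  have hne : minors P Q (i + 1) ≠ 0 ∨ minors P Q (i + 2) ≠ 0 := by
    by_contra! h
    rw [h.1, h.2, mul_zero, mul_zero, add_zero, add_zero] at hm
    have := (mul_eq_zero.1 hm).resolve_left he
    exact not_isUnit_zero (hall 0 (by rw [this]) (by rw [h.1]) (by rw [h.2]))
  obtain ⟨a, b, c, hab, hca, hcb⟩ := exists_reduced_factors_of_or_ne_zero hne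
  have hce : c ∣ P i := by
    have hrc : IsRelPrime c (minors P Q i) := fun r hr hr' =>
      hall r hr' (hr.trans ⟨a, hca.symm⟩) (hr.trans ⟨b, hcb.symm⟩)
    refine hrc.dvd_of_dvd_mul_right ?_
    exact ⟨-(P (i + 1) * a + P (i + 2) * b), by rw [← hca, ← hcb] at hm; linear_combination hm⟩
  let v : Fin 3 → R := Pi.single (i + 1) b - Pi.single (i + 2) a
  have hv1 : v (i + 1) = b := by simp [v, hi12.symm]
  have hv2 : v (i + 2) = -a := by simp [v, hi12]
  have hv0 : v ≠ 0 := by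
    intro h
    rw [h] at hv1 hv2
    have ha : a = 0 := by simpa using hv2.symm
    have hb : b = 0 := hv1.symm
    rw [← hca, ← hcb, ha, hb] at hne
    simp at hne
  have hvi : v i = 0 := by simp [v, hi1.symm, hi2.symm]
  have hirr : Irreducible (linForm v) := irreducible_linForm hv0 fun r hr =>
    hab (by simpa [hv2] using hr (i + 2)) (by simpa [hv1] using hr (i + 1))
  have hlv : C c * linForm v = aeval g (linForm Q) := by
    rw [hgG, hF, hG, linForm, sum_fin_three_cyclic _ i, hv1, hv2, hvi]
    have hca' := congrArg (C (σ := Fin 3)) hca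
    have hcb' := congrArg (C (σ := Fin 3)) hcb
    simp only [minors, hi3, hi4, hi5, hi6, map_sub, map_mul] at hca' hcb'
    simp only [map_neg, map_zero]
    linear_combination X (i + 1) * hcb' - X (i + 2) * hca'
  have hdvd : linForm v ∣ aeval g s := by
    obtain ⟨k, hk⟩ := hf0
    obtain ⟨x, y, hxy⟩ := Ideal.mem_span_pair.1 (C_pow_mul_mem_of_aeval_eq_zero hsyz hs h0 k)
    have h1 := congrArg (aeval g) hxy
    rw [map_add, map_mul, map_mul, hgF, ← hlv, map_mul, map_pow] at h1
    have hC : aeval g (C (f k)) = C (f k) := by simp [algebraMap_eq]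
    rw [hC] at h1
    have h2 : linForm v ∣ C (f k) ^ d * aeval g s := ⟨aeval g y * C c, by rw [← h1]; ring⟩
    refine (hirr.prime.dvd_or_dvd h2).resolve_left fun h3 => ?_
    have h4 := totalDegree_le_of_dvd_of_isDomain (hirr.prime.dvd_of_dvd_pow h3) (by simpa using hk)
    rw [(isHomogeneous_linForm v).totalDegree hirr.ne_zero] at h4
    simp at h4
  obtain ⟨q, hq⟩ := hdvd
  obtain ⟨m, hm'⟩ := hce
  have hmem : C (P i) * aeval g s ∈ Ideal.span {linForm P, linForm Q} := by
    have : C (P i) * aeval g s = C m * q * (C (P i) * linForm Q - C (Q i) * linForm P) := by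
      rw [hq, ← hgG, ← hlv, hm', map_mul]
      ring
    rw [this]
    exact Ideal.mul_mem_left _ _ (sub_mem (Ideal.mul_mem_left _ _ hGJ) (Ideal.mul_mem_left _ _ hFJ))
  have := sub_mem hmem (Ideal.mul_mem_left _ (C (P i)) hgJ)
  convert this using 1
  ring

end HilbertBurch

section Points

variable {K : Type*} [Field K]

theorem linForm_mem_pointIdeal {v w : Fin 3 → K} (h : ∑ i, w i * v i = 0) :
    linForm w ∈ pointIdeal v :=
  Ideal.subset_span ⟨⟨1, isHomogeneous_linForm w⟩, by simpa [linForm] using h⟩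

theorem isUnit_of_forall_dvd_pointIdeal {v : Fin 3 → K} (hv : v ≠ 0)
    {c : MvPolynomial (Fin 3) K} (hc : ∀ g ∈ pointIdeal v, c ∣ g) : IsUnit c := by
  obtain ⟨k, hk⟩ := Function.ne_iff.1 hv
  rw [Pi.zero_apply] at hk
  have hmem : ∀ j, linForm (v k • Pi.single j 1 - v j • Pi.single k 1) ∈ pointIdeal v := fun j => by
    refine linForm_mem_pointIdeal ?_
    simp [sub_mul, Finset.sum_sub_distrib, Pi.single_apply]
    ring
  have hk1 : k + 1 ≠ k := by simp
  have hk2 : k + 2 ≠ k := by simp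
  have hk12 : k + 2 ≠ k + 1 := by simp
  have hirr : Irreducible (linForm (v k • Pi.single (k + 1) 1 - v (k + 1) • Pi.single k 1)) := by
    have h1 : (v k • Pi.single (k + 1) 1 - v (k + 1) • Pi.single k 1 : Fin 3 → K) (k + 1) = v k := by
      simp [hk1]
    refine irreducible_linForm (fun h => hk ?_) fun c h => ?_
    · rw [← h1, h, Pi.zero_apply]
    · exact isUnit_of_dvd_unit ((h (k + 1)).trans h1.dvd) (isUnit_iff_ne_zero.2 hk)
  by_contra hu
  have hass := hirr.dvd_iff.1 (hc _ (hmem (k + 1)))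
  have hdvd := (hass.resolve_left hu).dvd.trans (hc _ (hmem (k + 2)))
  have h2 := map_dvd (eval (Pi.single (k + 2) 1)) hdvd
  simp [linForm, sub_mul, Finset.sum_sub_distrib, Pi.single_apply, hk2, hk12, hk] at h2

theorem isUnit_of_forall_dvd_iInf_pointIdeal {ι : Type*} [Fintype ι] {p : ι → Fin 3 → K}
    (hp : ∀ i, p i ≠ 0) {c : MvPolynomial (Fin 3) K} (hc : ∀ g ∈ ⨅ i, pointIdeal (p i), c ∣ g) :
    IsUnit c := by
  by_contra hu
  obtain ⟨q, hq, hqc⟩ : ∃ q, Prime q ∧ q ∣ c := by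
    rcases eq_or_ne c 0 with rfl | h0
    · exact ⟨X 0, X_prime, dvd_zero _⟩
    · obtain ⟨q, hq, h⟩ := WfDvdMonoid.exists_irreducible_factor hu h0
      exact ⟨q, hq.prime, h⟩
  have h : ∀ i, ∃ g ∈ pointIdeal (p i), ¬ q ∣ g := fun i => by
    by_contra! h
    exact hq.not_isUnit (isUnit_of_forall_dvd_pointIdeal (hp i) h)
  choose g hg hgq using h
  have hmem : ∏ i, g i ∈ ⨅ i, pointIdeal (p i) := by
    refine (Submodule.mem_iInf _).2 fun i => ?_
    exact Ideal.mem_of_dvd _ (Finset.dvd_prod_of_mem g (Finset.mem_univ i)) (hg i)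
  obtain ⟨i, -, hi⟩ := (hq.dvd_finsetProd_iff g).1 (hqc.trans (hc _ hmem))
  exact hgq i hi

theorem X_mem_of_linForm_mem {p : Ideal (MvPolynomial (Fin 3) K)} {v w : Fin 3 → K}
    (hv : pointIdeal v ≤ p) (hw : linForm w ∈ p) (hvw : ∑ i, w i * v i ≠ 0) (l : Fin 3) :
    X l ∈ p := by
  have h1 : linForm ((∑ i, w i * v i) • Pi.single l 1 - v l • w) ∈ p := by
    refine hv (linForm_mem_pointIdeal ?_)
    simp [sub_mul, Finset.sum_sub_distrib, Pi.single_apply, mul_assoc, ← Finset.mul_sum]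
    ring
  have h2 := add_mem h1 (p.mul_mem_left (C (v l)) hw)
  rw [C_mul_linForm, ← linForm_add, sub_add_cancel, ← C_mul_linForm] at h2
  have h3 := p.mul_mem_left (C (∑ i, w i * v i)⁻¹) h2
  rw [← mul_assoc, ← map_mul, inv_mul_cancel₀ hvw] at h3
  simpa [linForm, Pi.single_apply] using h3

theorem exists_linForm_separating {v w : Fin 3 → K} (hw : w ≠ 0) (h : ∀ t : K, v ≠ t • w) :
    ∃ a : Fin 3 → K, ∑ i, a i * w i = 0 ∧ ∑ i, a i * v i ≠ 0 := by
  by_contra! hall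
  obtain ⟨k, hk⟩ := Function.ne_iff.1 hw
  rw [Pi.zero_apply] at hk
  refine h (v k / w k) (funext fun j => ?_)
  have := hall (w k • Pi.single j 1 - w j • Pi.single k 1) (by
    simp [sub_mul, Finset.sum_sub_distrib, Pi.single_apply]; ring)
  simp [sub_mul, Finset.sum_sub_distrib, Pi.single_apply] at this
  rw [Pi.smul_apply, smul_eq_mul]
  field_simp
  linear_combination this

theorem X_mem_of_iInf_pointIdeal_le_sq {ι : Type*} [Fintype ι] {v : ι → Fin 3 → K}
    (hv0 : ∀ i, v i ≠ 0) (hv : ∀ i j, i ≠ j → ∀ t : K, v i ≠ t • v j)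
    {p : Ideal (MvPolynomial (Fin 3) K)} [hp : p.IsPrime]
    (h : ⨅ i, pointIdeal (v i) ≤ p * p) (l : Fin 3) : X l ∈ p := by
  classical
  obtain ⟨i, -, hi⟩ : ∃ i ∈ Finset.univ, pointIdeal (v i) ≤ p := by
    rw [← hp.inf_le', Finset.inf_univ_eq_iInf]
    exact h.trans Ideal.mul_le_left
  have hsep : ∀ j, ∃ a : Fin 3 → K, j ≠ i → ∑ k, a k * v j k = 0 ∧ ∑ k, a k * v i k ≠ 0 := fun j => by
    by_cases hj : j = i
    · exact ⟨0, fun h => absurd hj h⟩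
    · obtain ⟨a, ha⟩ := exists_linForm_separating (hv0 j) (hv i j (Ne.symm hj))
      exact ⟨a, fun _ => ha⟩
  choose a ha using hsep
  obtain ⟨k, hk⟩ := Function.ne_iff.1 (hv0 i)
  rw [Pi.zero_apply] at hk
  have hk1 : k ≠ k + 1 := by simp
  set ℓ : MvPolynomial (Fin 3) K :=
    linForm (v i k • Pi.single (k + 1) 1 - v i (k + 1) • Pi.single k 1) with hℓ
  have hℓi : ℓ ∈ pointIdeal (v i) := by
    refine linForm_mem_pointIdeal ?_
    simp [sub_mul, Finset.sum_sub_distrib, Pi.single_apply]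
    ring
  have hDℓ : pderiv (k + 1) ℓ = C (v i k) := by
    simp [hℓ, linForm, Pi.single_apply, sub_mul, Finset.sum_sub_distrib, pderiv_X]
  set s : MvPolynomial (Fin 3) K := ∏ j ∈ Finset.univ.erase i, linForm (a j) with hs
  have hmem : s * ℓ ∈ ⨅ i, pointIdeal (v i) := by
    refine (Submodule.mem_iInf _).2 fun j => ?_
    rcases eq_or_ne j i with rfl | hj
    · exact Ideal.mul_mem_left _ _ hℓi
    · refine Ideal.mul_mem_right _ _ (Ideal.mem_of_dvd _
        (Finset.dvd_prod_of_mem _ (Finset.mem_erase.2 ⟨hj, Finset.mem_univ j⟩)) ?_)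
      exact linForm_mem_pointIdeal (ha j hj).1
  have hD : ∀ g ∈ p * p, pderiv (k + 1) g ∈ p := fun g hg => by
    refine Submodule.mul_induction_on hg (fun x hx y hy => ?_) fun x y hx hy => ?_
    · rw [Derivation.leibniz, smul_eq_mul, smul_eq_mul]
      exact add_mem (p.mul_mem_right _ hx) (p.mul_mem_right _ hy)
    · rw [map_add]
      exact add_mem hx hy
  have h1 := hD _ (h hmem)
  rw [Derivation.leibniz, hDℓ, smul_eq_mul, smul_eq_mul] at h1
  have h2 : s * C (v i k) ∈ p := (Submodule.add_mem_iff_left _ (p.mul_mem_right _ (hi hℓi))).1 h1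
  have h3 : s ∈ p := by
    have := p.mul_mem_right (C (v i k)⁻¹) h2
    rwa [mul_assoc, ← map_mul, mul_inv_cancel₀ hk, map_one, mul_one] at this
  obtain ⟨j, hj, hjp⟩ := hp.prod_mem_iff.1 h3
  exact X_mem_of_linForm_mem hi hjp (ha j (Finset.ne_of_mem_erase hj)).2 l

theorem eq_top_of_X_mem_radical {A : Ideal (MvPolynomial (Fin 3) K)}
    (hrad : ∀ l, X l ∈ A.radical) (hA : ∀ a, (∀ l, X l * a ∈ A) → a ∈ A) : A = ⊤ := by
  have hle : Ideal.span (Set.range (X : Fin 3 → MvPolynomial (Fin 3) K)) ≤ A.radical :=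
    Ideal.span_le.2 (by rintro _ ⟨l, rfl⟩; exact hrad l)
  obtain ⟨n, hn⟩ := Ideal.exists_pow_le_of_le_radical_of_fg hle
    (IsNoetherian.noetherian _)
  induction n with
  | zero => simpa using hn
  | succ n ih =>
    refine ih fun a ha => hA a fun l => hn ?_
    rw [pow_succ']
    exact Ideal.mul_mem_mul (Ideal.subset_span ⟨l, rfl⟩) ha

end Points

theorem idealHeight_span_pair_eq_two {S : Type*} [CommRing S] [IsDomain S] [IsNoetherianRing S]
    [UniqueFactorizationMonoid S] {F G : S} (hF : F ≠ 0) (hrel : IsRelPrime F G)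
    (hJ : (Ideal.span {F, G}).IsPrime) : idealHeight (Ideal.span {F, G}) = 2 := by
  have hFJ : F ∈ Ideal.span {F, G} := Ideal.subset_span (by simp)
  have hGJ : G ∈ Ideal.span {F, G} := Ideal.subset_span (by simp)
  obtain ⟨q, hqF, hqJ, hq⟩ : ∃ q, q ∣ F ∧ q ∈ Ideal.span {F, G} ∧ Prime q := by
    have h1 := UniqueFactorizationMonoid.factors_prod hF
    have h2 : (UniqueFactorizationMonoid.factors F).prod ∈ Ideal.span {F, G} :=
      Ideal.mem_of_dvd _ h1.symm.dvd hFJ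
    obtain ⟨q, hq, hqJ⟩ := hJ.multiset_prod_mem_iff_exists_mem _ |>.1 h2
    exact ⟨q, UniqueFactorizationMonoid.dvd_of_mem_factors hq, hqJ,
      UniqueFactorizationMonoid.prime_of_factor q hq⟩
  have hqp : (Ideal.span {q}).IsPrime := (Ideal.span_singleton_prime hq.ne_zero).2 hq
  have h01 : (⟨⊥, Ideal.isPrime_bot⟩ : PrimeSpectrum S) < ⟨Ideal.span {q}, hqp⟩ :=
    (bot_lt_iff_ne_bot (α := Ideal S)).2 fun h => hq.ne_zero (Ideal.span_singleton_eq_bot.1 h)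
  have h12 : (⟨Ideal.span {q}, hqp⟩ : PrimeSpectrum S) < ⟨Ideal.span {F, G}, hJ⟩ := by
    refine lt_of_le_of_ne ((Ideal.span_singleton_le_iff_mem _).2 hqJ) fun h => ?_
    have hG : G ∈ Ideal.span {q} := by
      rw [PrimeSpectrum.mk.injEq] at h
      rw [h]
      exact hGJ
    exact hq.not_isUnit (hrel hqF (Ideal.mem_span_singleton.1 hG))
  apply le_antisymm
  · refine (iInf₂_le (⟨Ideal.span {F, G}, hJ⟩ : PrimeSpectrum S) le_rfl).trans ?_
    rw [← PrimeSpectrum.height_eq_orderHeight]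
    have hmin : Ideal.span {F, G} ∈ (Ideal.span {F, G}).minimalPrimes := by
      rw [Ideal.minimalPrimes_eq_subsingleton_self]
      rfl
    refine (Ideal.height_le_card_of_mem_minimalPrimes_span (Set.toFinite _) hmin).trans ?_
    exact_mod_cast Set.ncard_insert_le F {G} |>.trans (by simp)
  · refine le_iInf₂ fun P hP => ?_
    have hle : (⟨Ideal.span {F, G}, hJ⟩ : PrimeSpectrum S) ≤ P := hP
    calc (2 : ℕ∞) = 0 + 1 + 1 := by norm_num
      _ ≤ Order.height (⟨⊥, Ideal.isPrime_bot⟩ : PrimeSpectrum S) + 1 + 1 := by gcongr; exact zero_le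
      _ ≤ Order.height (⟨Ideal.span {q}, hqp⟩ : PrimeSpectrum S) + 1 := by
        gcongr
        exact Order.height_add_one_le h01
      _ ≤ Order.height (⟨Ideal.span {F, G}, hJ⟩ : PrimeSpectrum S) := Order.height_add_one_le h12
      _ ≤ Order.height P := Order.height_mono hle

theorem aeval_homogeneousComponent_eq_zero {R σ : Type*} [CommRing R] {f : σ → R}
    {s : MvPolynomial σ R}
    (hs : aeval (fun i => Polynomial.C (f i) * Polynomial.X) s = 0) (d : ℕ) :
    aeval f (homogeneousComponent d s) = 0 := by
  have h : ∀ n, aeval (fun i => Polynomial.C (f i) * Polynomial.X) (homogeneousComponent n s) =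
      Polynomial.C (aeval f (homogeneousComponent n s)) * Polynomial.X ^ n := fun n => by
    have h1 := aeval_algebraMap_apply (Polynomial R) f (homogeneousComponent n s)
    simp only [mul_comm (Polynomial.C _) Polynomial.X]
    rw [aeval_mul_left_of_isHomogeneous (homogeneousComponent_isHomogeneous n s), mul_comm]
    congr 1
  rw [← sum_homogeneousComponent s, map_sum] at hs
  have hc := congrArg (fun p => Polynomial.coeff p d) hs
  simp only [h, Polynomial.finsetSum_coeff, Polynomial.coeff_C_mul_X_pow,
    Polynomial.coeff_zero] at hc
  rw [Finset.sum_ite_eq] at hc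
  split_ifs at hc with hd
  · exact hc
  · rw [homogeneousComponent_eq_zero, map_zero]
    simpa using hd

theorem ker_aeval_C_mul_X_eq_span {K : Type*} [Field K] {ι : Type*} [Fintype ι]
    {p : ι → Fin 3 → K} (hp0 : ∀ i, p i ≠ 0) (hp : ∀ i j, i ≠ j → ∀ t : K, p i ≠ t • p j)
    {f P Q : Fin 3 → MvPolynomial (Fin 3) K}
    (hI : ⨅ i, pointIdeal (p i) = Ideal.span (Set.range f)) (hf0 : ∀ i, f i ≠ 0)
    (hsyz : ∀ v : Fin 3 → MvPolynomial (Fin 3) K,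
      (∑ i, v i * f i = 0) ↔ v ∈ Submodule.span (MvPolynomial (Fin 3) K) {P, Q}) :
    IsRelPrime (linForm P) (linForm Q) ∧
    RingHom.ker (aeval fun i => Polynomial.C (f i) * Polynomial.X :
      MvPolynomial (Fin 3) (MvPolynomial (Fin 3) K) →ₐ[MvPolynomial (Fin 3) K] _) =
      Ideal.span {linForm P, linForm Q} := by
  have hgcd : ∀ c, (∀ i, c ∣ f i) → IsUnit c := fun c hc => by
    refine isUnit_of_forall_dvd_iInf_pointIdeal hp0 fun g hg => ?_
    rw [hI] at hg
    rw [← Ideal.mem_span_singleton]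
    refine Ideal.span_le.2 ?_ hg
    rintro _ ⟨i, rfl⟩
    exact Ideal.mem_span_singleton.2 (hc i)
  obtain ⟨u, hu, hminors⟩ := exists_isUnit_minors_eq hf0 hgcd hsyz
  have hmgcd : ∀ c, (∀ i, c ∣ minors P Q i) → IsUnit c := fun c hc =>
    hgcd c fun i => by
      have := hc i
      rwa [hminors, hu.dvd_mul_left] at this
  have hrel := linForm_isRelPrime hmgcd
  refine ⟨hrel, le_antisymm (fun s hs => ?_) ?_⟩
  · rw [← sum_homogeneousComponent s]
    refine sum_mem fun d _ => ?_
    have h0 := aeval_homogeneousComponent_eq_zero (RingHom.mem_ker.1 hs) d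
    have hhom := homogeneousComponent_isHomogeneous d s
    set r := homogeneousComponent d s
    have hG0 : linForm Q ≠ 0 := by
      intro h
      have hQ : Q = 0 := linForm_injective (h.trans linForm_zero.symm)
      have := hminors 0
      simp only [minors, hQ, Pi.zero_apply, mul_zero, sub_zero] at this
      exact mul_ne_zero hu.ne_zero (hf0 0) this.symm
    let A : Ideal (MvPolynomial (Fin 3) K) :=
      Ideal.comap C ((Ideal.span {linForm P, linForm Q}).colon {r})
    have hA : ∀ a, a ∈ A ↔ C a * r ∈ Ideal.span {linForm P, linForm Q} := fun a => by
      rw [Ideal.mem_comap, Submodule.mem_colon_singleton, smul_eq_mul]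
    have htop : A = ⊤ := by
      refine eq_top_of_X_mem_radical (fun l => ?_) fun a ha => ?_
      · rw [Ideal.radical_eq_sInf, Ideal.mem_sInf]
        rintro 𝔭 ⟨hle, h𝔭⟩
        have hP : ∀ i, P i ∈ 𝔭 := fun i => h𝔭.mem_of_pow_mem (d + 1) (hle (by
          rw [hA, map_pow]
          exact C_entry_pow_mul_mem ⟨0, hf0 0⟩ hsyz hmgcd hhom h0 i))
        have hQ : ∀ i, Q i ∈ 𝔭 := fun i => h𝔭.mem_of_pow_mem (d + 1) (hle (by
          rw [hA, map_pow, Set.pair_comm]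
          refine C_entry_pow_mul_mem ⟨0, hf0 0⟩ (by rwa [Set.pair_comm]) (fun c hc => ?_) hhom h0 i
          refine hmgcd c fun i => ?_
          rw [← dvd_neg]
          convert hc i using 1
          simp only [minors]
          ring))
        refine X_mem_of_iInf_pointIdeal_le_sq hp0 hp ?_ l
        rw [hI, Ideal.span_le]
        rintro _ ⟨i, rfl⟩
        rw [SetLike.mem_coe, ← Ideal.unit_mul_mem_iff_mem _ hu, ← hminors]
        exact sub_mem (Ideal.mul_mem_mul (hP _) (hQ _)) (Ideal.mul_mem_mul (hP _) (hQ _))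
      · rw [hA]
        refine mem_of_X_mul_mem hrel hG0 fun l => ?_
        rw [← mul_assoc, ← map_mul, ← hA]
        exact ha l
    have h1 : (1 : MvPolynomial (Fin 3) K) ∈ A := htop ▸ Submodule.mem_top
    simpa using (hA 1).1 h1
  · have hker : ∀ v ∈ Submodule.span (MvPolynomial (Fin 3) K) {P, Q},
        aeval (fun i => Polynomial.C (f i) * Polynomial.X) (linForm v) = 0 := fun v hv => by
      have := congrArg (fun x => Polynomial.C x * Polynomial.X) ((hsyz v).2 hv)
      simpa [aeval_linForm, Polynomial.algebraMap_eq, Finset.sum_mul, mul_assoc] using this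
    rw [Ideal.span_le]
    rintro _ (rfl | rfl)
    · exact hker P (Submodule.subset_span (by simp))
    · exact hker Q (Submodule.subset_span (by simp))

/-- for a strict almost complete intersection `I = (f,g,h)` of
points in `P²` with Hilbert–Burch syzygies `(P₁,P₂,P₃)`, `(Q₁,Q₂,Q₃)`, the
kernel of `S = R[T₁,T₂,T₃] → R[t]`, `Tᵢ ↦ fᵢt`, equals `(F,G)` where
`F = ΣPᵢTᵢ`, `G = ΣQᵢTᵢ`, and `(F,G)` is a complete intersection of height 2;
moreover `(F,G)` is also the defining ideal of the symmetric algebra, so the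
Rees algebra and the symmetric algebra of `I` both equal `S/(F,G)`. -/
theorem rees_algebra_of_points_aci {K : Type*} [Field K]
    (I : Ideal (MvPolynomial (Fin 3) K))
    (f P Q : Fin 3 → MvPolynomial (Fin 3) K)
    (hpts : @DefinesReducedPoints K _ 2 I)
    (hgen : I = Ideal.span (Set.range f))
    (hmin : ∀ i, f i ∉ Ideal.span (f '' {j | j ≠ i}))
    (hsyz : ∀ v : Fin 3 → MvPolynomial (Fin 3) K,
      (∑ i, v i * f i = 0) ↔ v ∈ Submodule.span (MvPolynomial (Fin 3) K) {P, Q}) :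
    let R := MvPolynomial (Fin 3) K
    let φ : MvPolynomial (Fin 3) R →ₐ[R] Polynomial R :=
      aeval fun i => Polynomial.C (f i) * Polynomial.X
    let F : MvPolynomial (Fin 3) R := ∑ i, C (P i) * X i
    let G : MvPolynomial (Fin 3) R := ∑ i, C (Q i) * X i
    RingHom.ker φ = Ideal.span {F, G} ∧
      idealHeight (Ideal.span {F, G}) = 2 ∧
      Ideal.span {s : MvPolynomial (Fin 3) R |
          ∃ v : Fin 3 → R, (∑ i, v i * f i = 0) ∧ s = ∑ i, C (v i) * X i} =
        Ideal.span {F, G} := by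
  intro R φ F G
  obtain ⟨n, p, hp0, hp, hI⟩ := hpts
  have hf0 : ∀ i, f i ≠ 0 := fun i h => hmin i (h ▸ zero_mem _)
  obtain ⟨hrel, hker⟩ := ker_aeval_C_mul_X_eq_span hp0 hp (hI.symm.trans hgen) hf0 hsyz
  have hprime : (Ideal.span {linForm P, linForm Q}).IsPrime := hker ▸ RingHom.ker_isPrime _
  have hF0 : linForm P ≠ 0 := by
    intro h
    have hQ := hrel (by rw [h]; exact dvd_zero (linForm Q)) dvd_rfl
    exact hprime.ne_top (Ideal.eq_top_of_isUnit_mem _ (Ideal.subset_span (by simp)) hQ)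
  refine ⟨hker, idealHeight_span_pair_eq_two hF0 hrel hprime, le_antisymm ?_ ?_⟩
  · rw [Ideal.span_le]
    rintro _ ⟨v, hv, rfl⟩
    obtain ⟨α, β, rfl⟩ := Submodule.mem_span_pair.1 ((hsyz v).1 hv)
    refine Ideal.mem_span_pair.2 ⟨C α, C β, ?_⟩
    change C α * linForm P + C β * linForm Q = linForm (α • P + β • Q)
    rw [C_mul_linForm, C_mul_linForm, linForm_add]
  · refine Ideal.span_mono ?_
    rintro _ (rfl | rfl)
    · exact ⟨P, (hsyz P).2 (Submodule.subset_span (by simp)), rfl⟩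
    · exact ⟨Q, (hsyz Q).2 (Submodule.subset_span (by simp)), rfl⟩

end
end

section
/- Let K be a field, R = K[x,y,z], and let I = (f,g,h) be a strict almost complete intersection ideal defining a reduced set of points in P^2, with f,g,h homogeneous of the same degree d, and syzygy generators (P_1,P_2,P_3) of degree d_0 and (Q_1,Q_2,Q_3) of degree d_1 (d_0 + d_1 = d). Write f_1,f_2,f_3 = f,g,h. Then the following sequence of R-modules is exact: 0 → R → R^3 ⊕ R^3 → R^6 → I^2 → 0, where R^6 has basis {e_{ij} : 1 ≤ i ≤ j ≤ 3} mapping onto I^2 by e_{ij} ↦ f_i f_j; the middle map sends the k-th basis vector of the first summand R^3 to Σ_{i=1}^3 P_i e_{ik} and the k-th basis vector of the second summand to Σ_{i=1}^3 Q_i e_{ik} (where e_{ik} = e_{ki}); and the first map sends 1 to (−Q_1,−Q_2,−Q_3, P_1,P_2,P_3). This is the minimal free resolution of I^2, with twists 0 → R(−3d) → R(−2d−d_0)^3 ⊕ R(−2d−d_1)^3 → R(−2d)^6 → I^2 → 0. -/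
open MvPolynomial

noncomputable section

/-- Index set for the symmetric pairs `{(i,j) : i ≤ j}` in `Fin 3`. -/
abbrev SymPair : Type := {p : Fin 3 × Fin 3 // p.1 ≤ p.2}

/-- The "unordered" unit vector `e_{ij} = e_{ji}` of `R^6`. -/
def symE {R : Type*} [CommRing R] (i j : Fin 3) : SymPair → R :=
  fun q => if q.val = (i, j) ∨ q.val = (j, i) then 1 else 0

/-- The signed `2 × 2` minors of the `3 × 2` matrix with columns `P` and `Q`. -/
def signedMinors {R : Type*} [CommRing R] (P Q : Fin 3 → R) : Fin 3 → R :=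
  ![P 1 * Q 2 - P 2 * Q 1, P 2 * Q 0 - P 0 * Q 2, P 0 * Q 1 - P 1 * Q 0]

/-- The pair `P, Q` generates the module of syzygies of `f`. -/
structure IsSyzygyPair {R : Type*} [CommRing R] (f P Q : Fin 3 → R) : Prop where
  left : ∑ i, P i * f i = 0
  right : ∑ i, Q i * f i = 0
  exists_eq : ∀ v : Fin 3 → R, ∑ i, v i * f i = 0 → ∃ a b, ∀ i, v i = a * P i + b * Q i

/-- The symmetric product `∑ᵢ vᵢ e_{ik}` of `v` with the `k`-th unit vector. -/
def symMul {R : Type*} [CommRing R] (v : Fin 3 → R) (k : Fin 3) : SymPair → R :=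
  ∑ i, v i • symE i k

section Algebra

variable {R : Type*} [CommRing R] {f P Q : Fin 3 → R}

theorem sum_symPair {M : Type*} [AddCommMonoid M] (F : SymPair → M) :
    ∑ p, F p = F ⟨(0, 0), by decide⟩ + F ⟨(0, 1), by decide⟩ + F ⟨(0, 2), by decide⟩ +
      F ⟨(1, 1), by decide⟩ + F ⟨(1, 2), by decide⟩ + F ⟨(2, 2), by decide⟩ := by
  have : (Finset.univ : Finset SymPair) =
      {⟨(0, 0), by decide⟩, ⟨(0, 1), by decide⟩, ⟨(0, 2), by decide⟩, ⟨(1, 1), by decide⟩,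
        ⟨(1, 2), by decide⟩, ⟨(2, 2), by decide⟩} := by decide
  rw [this]
  simp [add_assoc]

theorem sum_fin_three_of_ne {M : Type*} [AddCommMonoid M] {i j k : Fin 3} (hij : i ≠ j)
    (hik : i ≠ k) (hjk : j ≠ k) (F : Fin 3 → M) : ∑ l, F l = F i + F j + F k := by
  have : (Finset.univ : Finset (Fin 3)) = {i, j, k} := by
    revert i j k; decide
  rw [this, Finset.sum_insert (by simp [hij, hik]), Finset.sum_insert (by simp [hjk]),
    Finset.sum_singleton, add_assoc]

theorem symE_comm (i j : Fin 3) : (symE i j : SymPair → R) = symE j i := by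
  funext q
  simp only [symE, or_comm]

theorem IsSyzygyPair.swap (h : IsSyzygyPair f P Q) : IsSyzygyPair f Q P :=
  ⟨h.right, h.left, fun v hv => by
    obtain ⟨a, b, hab⟩ := h.exists_eq v hv
    exact ⟨b, a, fun i => by rw [hab, add_comm]⟩⟩

theorem IsSyzygyPair.exists_koszul_eq (h : IsSyzygyPair f P Q) (i : Fin 3) :
    ∃ r, ∀ j, f i * f j = r * signedMinors P Q j := by
  have e1 := h.exists_eq ![f 1, -f 0, 0] (by simp [Fin.sum_univ_three]; ring)
  have e2 := h.exists_eq ![f 2, 0, -f 0] (by simp [Fin.sum_univ_three]; ring)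
  have e3 := h.exists_eq ![0, f 2, -f 1] (by simp [Fin.sum_univ_three]; ring)
  obtain ⟨a, b, e1⟩ := e1
  obtain ⟨a', b', e2⟩ := e2
  obtain ⟨a'', b'', e3⟩ := e3
  simp only [Fin.forall_fin_succ, Fin.isValue] at e1 e2 e3
  simp at e1 e2 e3
  obtain ⟨x0, x1, x2⟩ := e1
  obtain ⟨y0, y1, y2⟩ := e2
  obtain ⟨z0, z1, z2⟩ := e3
  have mul_eq : ∀ {s t s' t' : R}, s = t → s' = t' → s * s' = t * t' := by
    rintro s _ s' _ rfl rfl; rfl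
  fin_cases i
  · refine ⟨a * b' - a' * b, fun j => ?_⟩
    fin_cases j <;> simp [signedMinors]
    · linear_combination mul_eq x1 y2 - mul_eq x2 y1
    · linear_combination mul_eq x2 y0 - mul_eq x0 y2
    · linear_combination mul_eq x0 y1 - mul_eq x1 y0
  · refine ⟨a * b'' - a'' * b, fun j => ?_⟩
    fin_cases j <;> simp [signedMinors]
    · linear_combination mul_eq x1 z2 - mul_eq x2 z1
    · linear_combination mul_eq x2 z0 - mul_eq x0 z2
    · linear_combination mul_eq x0 z1 - mul_eq x1 z0
  · refine ⟨a' * b'' - a'' * b', fun j => ?_⟩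
    fin_cases j <;> simp [signedMinors]
    · linear_combination mul_eq y1 z2 - mul_eq y2 z1
    · linear_combination mul_eq y2 z0 - mul_eq y0 z2
    · linear_combination mul_eq y0 z1 - mul_eq y1 z0

/-- A relation between `f i` and `f j` is, after multiplying by `P k`, a Koszul relation. -/
theorem IsSyzygyPair.exists_eq_koszul (h : IsSyzygyPair f P Q) {i j k : Fin 3} (hij : i ≠ j)
    (hik : i ≠ k) (hjk : j ≠ k) {u : R} (h₁ : P k * Q i - P i * Q k = u * f j)
    (h₂ : P k * Q j - P j * Q k = -(u * f i)) {x y : R} (hxy : x * f i + y * f j = 0) :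
    ∃ b, P k * x = b * f j ∧ P k * y = -(b * f i) := by
  obtain ⟨a, b, hab⟩ := h.exists_eq (Pi.single i x + Pi.single j y) (by
    rw [sum_fin_three_of_ne hij hik hjk]
    simpa [hij, hij.symm, hik.symm, hjk.symm] using hxy)
  have hi := hab i
  have hj := hab j
  have hk := hab k
  simp [hij, hij.symm, hik.symm, hjk.symm] at hi hj hk
  refine ⟨b * u, ?_, ?_⟩
  · linear_combination P k * hi + b * h₁ - P i * hk
  · linear_combination P k * hj + b * h₂ - P j * hk

theorem IsSyzygyPair.exists_quadratic_eq_koszul (h : IsSyzygyPair f P Q) {i j k : Fin 3}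
    (hij : i ≠ j) (hik : i ≠ k) (hjk : j ≠ k) {u : R} (h₁ : P k * Q i - P i * Q k = u * f j)
    (h₂ : P k * Q j - P j * Q k = -(u * f i)) {x y z : R}
    (hxyz : x * (f i * f i) + y * (f i * f j) + z * (f j * f j) = 0) :
    ∃ r s, P k ^ 3 * x = r * f j ∧ P k ^ 3 * y = s * f j - r * f i ∧
      P k ^ 3 * z = -(s * f i) := by
  obtain ⟨b, hb, hb'⟩ := h.exists_eq_koszul hij hik hjk h₁ h₂ (x := x * f i + y * f j)
    (y := z * f j) (by linear_combination hxyz)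
  obtain ⟨c, hc, hc'⟩ := h.exists_eq_koszul hij hik hjk h₁ h₂ (x := b) (y := P k * z)
    (by linear_combination hb')
  obtain ⟨e, he, he'⟩ := h.exists_eq_koszul hij hik hjk h₁ h₂ (x := P k ^ 2 * x)
    (y := P k ^ 2 * y - c * f j) (by linear_combination P k * hb + f j * hc)
  exact ⟨e, P k * c, by linear_combination he, by linear_combination he',
    by linear_combination P k * hc'⟩

theorem IsSyzygyPair.pow_smul_mem (h : IsSyzygyPair f P Q) {M : Type*} [AddCommGroup M]
    [Module R M] {N : Submodule R M} {E : Fin 3 → Fin 3 → M} (hE : ∀ i j, E i j = E j i)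
    (hN : ∀ v : Fin 3 → R, ∑ i, v i * f i = 0 → ∀ k, ∑ i, v i • E i k ∈ N)
    {i j k : Fin 3} (hij : i ≠ j) (hik : i ≠ k) (hjk : j ≠ k) {u : R}
    (h₁ : P k * Q i - P i * Q k = u * f j) (h₂ : P k * Q j - P j * Q k = -(u * f i))
    {q : M} {cii cij cjj cki ckj ckk : R}
    (hq : q = cii • E i i + cij • E i j + cjj • E j j + cki • E k i + ckj • E k j + ckk • E k k)
    (hc : cii * (f i * f i) + cij * (f i * f j) + cjj * (f j * f j) + cki * (f k * f i) +
      ckj * (f k * f j) + ckk * (f k * f k) = 0) :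
    P k ^ 5 • q ∈ N := by
  have hP := h.left
  rw [sum_fin_three_of_ne hij hik hjk] at hP
  have hn : ∀ l, P i • E i l + P j • E j l + P k • E k l ∈ N := fun l => by
    have := hN P h.left l
    rwa [sum_fin_three_of_ne hij hik hjk] at this
  have hm : ∀ l, f j • E i l - f i • E j l ∈ N := fun l => by
    have := hN (Pi.single i (f j) + Pi.single j (-f i)) (by
      rw [sum_fin_three_of_ne hij hik hjk]
      simp [hij, hij.symm, hik.symm, hjk.symm]
      ring) l
    rw [sum_fin_three_of_ne hij hik hjk] at this
    simpa [hij, hij.symm, hik.symm, hjk.symm, sub_eq_add_neg] using this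
  obtain ⟨r, s, hr, hrs, hs⟩ := h.exists_quadratic_eq_koszul hij hik hjk h₁ h₂
    (x := P k ^ 2 * cii - (P k * cki - ckk * P i) * P i)
    (y := P k ^ 2 * cij - (P k * cki - ckk * P i) * P j - (P k * ckj - ckk * P j) * P i)
    (z := P k ^ 2 * cjj - (P k * ckj - ckk * P j) * P j)
    (by linear_combination P k ^ 2 * hc - (P k * ckk * f k + (P k * cki - ckk * P i) * f i +
      (P k * ckj - ckk * P j) * f j) * hP)
  have key : P k ^ 5 • q = (P k ^ 3 * (P k * ckk)) • (P i • E i k + P j • E j k + P k • E k k) +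
      (P k ^ 3 * (P k * cki - ckk * P i)) • (P i • E i i + P j • E j i + P k • E k i) +
      (P k ^ 3 * (P k * ckj - ckk * P j)) • (P i • E i j + P j • E j j + P k • E k j) +
      r • (f j • E i i - f i • E j i) + s • (f j • E i j - f i • E j j) := by
    have t1 := congrArg (fun t => t • E i i) hr
    have t2 := congrArg (fun t => t • E i j) hrs
    have t3 := congrArg (fun t => t • E j j) hs
    rw [hq, hE j i, hE i k, hE j k]
    linear_combination (norm := module) t1 + t2 + t3
  rw [key]
  exact N.add_mem (N.add_mem (N.add_mem (N.add_mem (N.smul_mem _ (hn k)) (N.smul_mem _ (hn i)))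
    (N.smul_mem _ (hn j))) (N.smul_mem _ (hm i))) (N.smul_mem _ (hm j))

end Algebra
section Domain

variable {R : Type*} [CommRing R] [IsDomain R] {f P Q : Fin 3 → R}

/-- A Hilbert–Burch statement: generators without common prime factor agree, up to a unit, with
the maximal minors of their syzygy matrix. -/
theorem IsSyzygyPair.exists_unit_signedMinors [UniqueFactorizationMonoid R]
    (h : IsSyzygyPair f P Q) (hf : f 0 ≠ 0) (hprime : ∀ π, Prime π → ∃ i, ¬ π ∣ f i) :
    ∃ u, IsUnit u ∧ ∀ i, signedMinors P Q i = u * f i := by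
  have hP := h.left
  have hQ := h.right
  simp only [Fin.sum_univ_three] at hP hQ
  have hpar : ∀ j, f 0 * signedMinors P Q j = f j * signedMinors P Q 0 := by
    intro j
    fin_cases j <;> simp [signedMinors]
    · linear_combination P 2 * hQ - Q 2 * hP
    · linear_combination Q 1 * hP - P 1 * hQ
  obtain ⟨f', m', g, hrel, hg, hg'⟩ :=
    UniqueFactorizationMonoid.exists_reduced_factors (f 0) hf (signedMinors P Q 0)
  have hg0 : g ≠ 0 := by rintro rfl; simp at hg; exact hf hg.symm
  have hdvd : ∀ j, f' ∣ f j := fun j => by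
    have : f' * signedMinors P Q j = m' * f j := by
      apply mul_left_cancel₀ hg0
      have := hpar j
      rw [← hg, ← hg'] at this
      linear_combination this
    exact hrel.dvd_of_dvd_mul_left ⟨_, this.symm⟩
  have hunit : IsUnit f' := by
    by_contra hnu
    have hf'0 : f' ≠ 0 := by rintro rfl; simp at hg; exact hf hg.symm
    obtain ⟨π, hπ, hπf⟩ := WfDvdMonoid.exists_irreducible_factor hnu hf'0
    obtain ⟨i, hi⟩ := hprime π hπ.prime
    exact hi (hπf.trans (hdvd i))
  obtain ⟨w, rfl⟩ := hunit
  have hu : ∀ j, signedMinors P Q j = (m' * ↑w⁻¹) * f j := by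
    intro j
    apply mul_left_cancel₀ hf
    rw [hpar j, ← hg, ← hg']
    linear_combination (-(f j * g * m')) * w.mul_inv
  refine ⟨m' * ↑w⁻¹, ?_, hu⟩
  by_contra hnu
  have hdvd' : ∀ i, m' * ↑w⁻¹ ∣ f i := fun i => by
    by_cases hi : f i = 0
    · simp [hi]
    obtain ⟨r, hr⟩ := h.exists_koszul_eq i
    refine ⟨r, mul_left_cancel₀ hi ?_⟩
    rw [hr i, hu i]
    ring
  have hu0 : m' * (↑w⁻¹ : R) ≠ 0 := fun h0 => hf (zero_dvd_iff.mp (h0 ▸ hdvd' 0))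
  obtain ⟨π, hπ, hπu⟩ := WfDvdMonoid.exists_irreducible_factor hnu hu0
  obtain ⟨i, hi⟩ := hprime π hπ.prime
  exact hi (hπu.trans (hdvd' i))

theorem IsSyzygyPair.exists_eq_of_sum_symMul_eq_zero (h : IsSyzygyPair f P Q)
    (hm : ∀ i, signedMinors P Q i ≠ 0) {a b : Fin 3 → R}
    (hab : ∑ k, a k • symMul P k + ∑ k, b k • symMul Q k = 0) :
    ∃ c, (∀ k, a k = c * -Q k) ∧ ∀ k, b k = c * P k := by
  have e00 := congrFun hab ⟨(0, 0), by decide⟩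
  have e01 := congrFun hab ⟨(0, 1), by decide⟩
  have e02 := congrFun hab ⟨(0, 2), by decide⟩
  have e11 := congrFun hab ⟨(1, 1), by decide⟩
  have e12 := congrFun hab ⟨(1, 2), by decide⟩
  have e22 := congrFun hab ⟨(2, 2), by decide⟩
  simp [symMul, symE, Fin.sum_univ_three] at e00 e01 e02 e11 e12 e22
  have c0 : a 1 * Q 2 = a 2 * Q 1 := by
    apply sub_eq_zero.mp
    apply (mul_eq_zero.mp _).resolve_left (hm 0)
    simp only [signedMinors, Matrix.cons_val]
    linear_combination Q 2 ^ 2 * e11 - Q 1 * Q 2 * e12 + Q 1 ^ 2 * e22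
  have c1 : a 2 * Q 0 = a 0 * Q 2 := by
    apply sub_eq_zero.mp
    apply (mul_eq_zero.mp _).resolve_left (hm 1)
    simp only [signedMinors, Matrix.cons_val]
    linear_combination Q 0 ^ 2 * e22 - Q 0 * Q 2 * e02 + Q 2 ^ 2 * e00
  have c2 : a 0 * Q 1 = a 1 * Q 0 := by
    apply sub_eq_zero.mp
    apply (mul_eq_zero.mp _).resolve_left (hm 2)
    simp only [signedMinors, Matrix.cons_val]
    linear_combination Q 1 ^ 2 * e00 - Q 0 * Q 1 * e01 + Q 0 ^ 2 * e11
  obtain ⟨k, hk⟩ : ∃ k, Q k ≠ 0 := by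
    by_contra! hQ0
    exact hm 0 (by simp [signedMinors, hQ0])
  have hcross : ∀ i, Q k * a i = a k * Q i := by
    intro i
    fin_cases k <;> fin_cases i <;> simp
    · ring
    · linear_combination -c2
    · linear_combination c1
    · linear_combination c2
    · ring
    · linear_combination -c0
    · linear_combination -c1
    · linear_combination c0
    · ring
  have haf : ∑ i, a i * f i = 0 := by
    apply (mul_eq_zero.mp _).resolve_left hk
    rw [Finset.mul_sum]
    calc ∑ i, Q k * (a i * f i) = a k * ∑ i, Q i * f i := by
          rw [Finset.mul_sum]
          exact Finset.sum_congr rfl fun i _ => by linear_combination f i * hcross i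
      _ = 0 := by rw [h.right, mul_zero]
  obtain ⟨x, y, hxy⟩ := h.exists_eq a haf
  have hx : x = 0 := by
    apply (mul_eq_zero.mp _).resolve_right (hm 0)
    simp only [signedMinors, Matrix.cons_val]
    rw [hxy, hxy] at c0
    linear_combination c0
  subst hx
  have d : ∀ i, a i = y * Q i := fun i => by rw [hxy]; ring
  rw [d 0] at e00 e01 e02
  rw [d 1] at e01 e11 e12
  rw [d 2] at e02 e12 e22
  refine ⟨-y, fun i => by rw [d]; ring, ?_⟩
  have key : ∀ i, Q k * Q k * (y * P i + b i) = 0 := by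
    intro i
    fin_cases k <;> fin_cases i <;> simp only [Fin.zero_eta, Fin.mk_one, Fin.reduceFinMk]
    · linear_combination Q 0 * e00
    · linear_combination Q 0 * e01 - Q 1 * e00
    · linear_combination Q 0 * e02 - Q 2 * e00
    · linear_combination Q 1 * e01 - Q 0 * e11
    · linear_combination Q 1 * e11
    · linear_combination Q 1 * e12 - Q 2 * e11
    · linear_combination Q 2 * e02 - Q 0 * e22
    · linear_combination Q 2 * e12 - Q 1 * e22
    · linear_combination Q 2 * e22
  intro i
  have := (mul_eq_zero.mp (key i)).resolve_left (mul_ne_zero hk hk)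
  linear_combination this

end Domain

/-- If `0 → R → A → B` is exact and some regular sequence `x, y, z` multiplies `q` into the image
of `A → B`, then `q` lies in that image. -/
theorem mem_range_of_regular_smul_mem {R A B : Type*} [CommRing R] [AddCommGroup A] [Module R A]
    [AddCommGroup B] [Module R B] {α : R →ₗ[R] A} {β : A →ₗ[R] B} (hα : Function.Injective α)
    (hαβ : LinearMap.range α = LinearMap.ker β) {x y z : R}
    (hx : ∀ b : B, x • b = 0 → b = 0)
    (hxy : ∀ a b : A, y • a = x • b → ∃ c, a = x • c)
    (hxyz : ∀ a b c : R, z * a = y * b - x * c → ∃ r s, a = y * r - x * s) {q : B}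
    (hxq : x • q ∈ LinearMap.range β) (hyq : y • q ∈ LinearMap.range β)
    (hzq : z • q ∈ LinearMap.range β) : q ∈ LinearMap.range β := by
  obtain ⟨a, ha⟩ := hxq
  obtain ⟨b, hb⟩ := hyq
  obtain ⟨e, he⟩ := hzq
  have lift : ∀ v, β v = 0 → ∃ c, α c = v := fun v hv => by
    rwa [← LinearMap.mem_ker, ← hαβ] at hv
  have hβα : ∀ r, β (α r) = 0 := fun r => by
    rw [← LinearMap.mem_ker, ← hαβ]
    exact ⟨r, rfl⟩
  obtain ⟨c, hc⟩ := lift (y • a - x • b) (by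
    rw [map_sub, map_smul, map_smul, ha, hb]; module)
  obtain ⟨c', hc'⟩ := lift (z • a - x • e) (by
    rw [map_sub, map_smul, map_smul, ha, he]; module)
  obtain ⟨c'', hc''⟩ := lift (z • b - y • e) (by
    rw [map_sub, map_smul, map_smul, hb, he]; module)
  obtain ⟨r, s, hrs⟩ := hxyz c c' c'' (by
    apply hα
    simp only [← smul_eq_mul, map_sub, map_smul, hc, hc', hc'']
    module)
  have hc₂ : α c = y • α r - x • α s := by
    rw [hrs, map_sub, ← smul_eq_mul, ← smul_eq_mul, map_smul, map_smul]
  obtain ⟨t, ht⟩ := hxy (a - α r) (b - α s) (by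
    linear_combination (norm := module) hc₂ - hc)
  refine ⟨t, ?_⟩
  rw [← sub_eq_zero]
  apply hx
  rw [smul_sub, ← map_smul, ← ht, map_sub, ha, hβα]
  simp

section Points

variable {K : Type*} [Field K]

theorem X_pow_dvd_of_mul_eq {σ : Type*} {i j : σ} (hij : i ≠ j) (n : ℕ)
    {a b : MvPolynomial σ K} (h : X j ^ n * a = X i ^ n * b) : X i ^ n ∣ a := by
  refine X_prime.pow_dvd_of_dvd_mul_left n ?_ ⟨b, h⟩
  exact fun hd => hij (X_dvd_X.mp (X_prime.dvd_of_dvd_pow hd))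

theorem exists_eq_of_X_pow_mul_eq {σ : Type*} {i j k : σ} (hik : i ≠ k) (hjk : j ≠ k) (n : ℕ)
    {a b c : MvPolynomial σ K} (h : X k ^ n * a = X j ^ n * b - X i ^ n * c) :
    ∃ r s, a = X j ^ n * r - X i ^ n * s := by
  classical
  have hspan : ∀ t : MvPolynomial σ K,
      t ∈ Ideal.span {X j ^ n, X i ^ n} ↔ ∀ m ∈ t.support, n ≤ m j ∨ n ≤ m i := by
    intro t
    have : ({X j ^ n, X i ^ n} : Set (MvPolynomial σ K)) =
        (fun s => monomial s 1) '' {Finsupp.single j n, Finsupp.single i n} := by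
      simp [Set.image_pair, X_pow_eq_monomial]
    rw [this, mem_ideal_span_monomial_image]
    simp
  have ha : a ∈ Ideal.span {X j ^ n, X i ^ n} := by
    rw [hspan]
    have hka : X k ^ n * a ∈ Ideal.span {X j ^ n, X i ^ n} := by
      rw [h, Ideal.mem_span_pair]
      exact ⟨b, -c, by ring⟩
    rw [hspan] at hka
    intro m hm
    have := hka (Finsupp.single k n + m) (by
      rw [mem_support_iff, X_pow_eq_monomial, coeff_monomial_mul, one_mul]
      exact mem_support_iff.mp hm)
    simpa [hik, hjk, hik.symm, hjk.symm] using this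
  rw [Ideal.mem_span_pair] at ha
  obtain ⟨r, s, hrs⟩ := ha
  exact ⟨r, -s, by rw [← hrs]; ring⟩

theorem linear_mem_pointIdeal {n : ℕ} (v : Fin n → K) (a b : Fin n) :
    C (v b) * X a - C (v a) * X b ∈ pointIdeal v :=
  Ideal.subset_span ⟨⟨1, ((isHomogeneous_C_mul_X _ _).sub (isHomogeneous_C_mul_X _ _))⟩,
    by simp [mul_comm]⟩

theorem X_mem_of_pointIdeal_le {n : ℕ} {v : Fin n → K} (hv : v ≠ 0)
    {q : Ideal (MvPolynomial (Fin n) K)} (hq : q.IsPrime) (hle : pointIdeal v ≤ q)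
    {F : MvPolynomial (Fin n) K} {e : ℕ} (hF : F.IsHomogeneous e) (hFq : F ∈ q)
    (hFv : eval v F ≠ 0) (i : Fin n) : X i ∈ q := by
  obtain ⟨b, hb⟩ := Function.ne_iff.mp hv
  simp only [Pi.zero_apply] at hb
  have hC : ∀ c : K, c ≠ 0 → ∀ g, C c * g ∈ q → g ∈ q := fun c hc g hg => by
    have := q.mul_mem_left (C c⁻¹) hg
    rwa [← mul_assoc, ← C_mul, inv_mul_cancel₀ hc, C_1, one_mul] at this
  have hG : C (v b ^ e) * F - C (eval v F) * X b ^ e ∈ pointIdeal v :=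
    Ideal.subset_span ⟨⟨e, (hF.C_mul _).sub ((isHomogeneous_X_pow b e).C_mul _)⟩,
      by simp [mul_comm]⟩
  have hXb : X b ∈ q := by
    refine hq.mem_of_pow_mem e (hC _ hFv _ ?_)
    have := q.sub_mem (q.mul_mem_left (C (v b ^ e)) hFq) (hle hG)
    simpa using this
  refine hC _ hb _ ?_
  have := q.add_mem (hle (linear_mem_pointIdeal v i b)) (q.mul_mem_left (C (v i)) hXb)
  simpa using this

theorem not_pointIdeal_le_span_singleton {v : Fin 3 → K} (hv : v ≠ 0)
    {π : MvPolynomial (Fin 3) K} (hπ : ¬ IsUnit π) : ¬ pointIdeal v ≤ Ideal.span {π} := by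
  intro hle
  obtain ⟨k, hk⟩ := Function.ne_iff.mp hv
  simp only [Pi.zero_apply] at hk
  obtain ⟨i, j, hij, hik, hjk⟩ : ∃ i j : Fin 3, i ≠ j ∧ i ≠ k ∧ j ≠ k := by
    clear hk
    revert k; decide
  have hdvd : ∀ l, π ∣ C (v k) * X l - C (v l) * X k := fun l =>
    Ideal.mem_span_singleton.mp (hle (linear_mem_pointIdeal v l k))
  have hdeg : ∀ l, (C (v k) * X l - C (v l) * X k : MvPolynomial (Fin 3) K).totalDegree ≤ 1 :=
    fun l => ((isHomogeneous_C_mul_X _ _).sub (isHomogeneous_C_mul_X _ _)).totalDegree_le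
  have hval : ∀ l l', eval (Pi.single l' 1) (C (v k) * X l - C (v l) * X k) =
      v k * (Pi.single l' 1 : Fin 3 → K) l - v l * (Pi.single l' 1 : Fin 3 → K) k := by
    intro l l'
    simp
  have hconst : ∀ l, l ≠ k → ∃ c : K, c ≠ 0 ∧ C (v k) * X l - C (v l) * X k = π * C c := by
    intro l hl
    obtain ⟨r, hr⟩ := hdvd l
    have hne : C (v k) * X l - C (v l) * X k ≠ (0 : MvPolynomial (Fin 3) K) := fun h0 => by
      have := hval l l
      rw [h0] at this
      simp [hl.symm] at this
      exact hk this.symm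
    have hπ0 : π ≠ 0 := by rintro rfl; exact hne (by rw [hr, zero_mul])
    have hr0 : r ≠ 0 := by rintro rfl; exact hne (by rw [hr, mul_zero])
    have hsum := hdeg l
    rw [hr, totalDegree_mul_of_isDomain hπ0 hr0] at hsum
    have hπd : π.totalDegree ≠ 0 := fun h0 => by
      rw [totalDegree_eq_zero_iff_eq_C] at h0
      rw [h0] at hπ hπ0
      exact hπ ((isUnit_iff_ne_zero.mpr fun h => hπ0 (by rw [h, C_0])).map C)
    have hrC := totalDegree_eq_zero_iff_eq_C.mp (show r.totalDegree = 0 by omega)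
    refine ⟨coeff 0 r, fun h => hr0 (by rw [hrC, h, C_0]), ?_⟩
    rw [← hrC, hr]
  obtain ⟨c, hc, hci⟩ := hconst i hik
  obtain ⟨c', hc', hcj⟩ := hconst j hjk
  have h1 := hval i i
  have h2 := hval j i
  rw [hci] at h1
  rw [hcj] at h2
  simp [hij.symm, hik.symm, hc'] at h1 h2
  rw [h2, zero_mul] at h1
  exact hk h1.symm

theorem exists_mem_pointIdeal_eval_ne_zero {n : ℕ} {v w : Fin n → K} (hw : w ≠ 0)
    (hvw : ∀ t : K, v ≠ t • w) : ∃ g ∈ pointIdeal w, eval v g ≠ 0 := by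
  obtain ⟨b, hb⟩ := Function.ne_iff.mp hw
  simp only [Pi.zero_apply] at hb
  by_contra! hall
  refine hvw (v b / w b) (funext fun a => ?_)
  have := hall _ (linear_mem_pointIdeal w a b)
  simp at this
  simp only [Pi.smul_apply, smul_eq_mul]
  field_simp
  linear_combination this

theorem exists_mem_pointIdeal_pderiv_ne_zero {n : ℕ} (hn : 2 ≤ n) {v : Fin n → K}
    (hv : v ≠ 0) : ∃ a, ∃ g ∈ pointIdeal v, eval v g = 0 ∧ eval v (pderiv a g) ≠ 0 := by
  obtain ⟨b, hb⟩ := Function.ne_iff.mp hv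
  simp only [Pi.zero_apply] at hb
  have : Nontrivial (Fin n) := Fin.nontrivial_iff_two_le.mpr hn
  obtain ⟨a, ha⟩ := exists_ne b
  refine ⟨a, _, linear_mem_pointIdeal v a b, by simp [mul_comm], ?_⟩
  simpa [pderiv_X, Pi.single_apply, ha.symm] using hb

/-- The ideal of a set of distinct points contains, for each of the points, a polynomial that is
not singular there. -/
theorem exists_mem_iInf_pderiv_ne_zero {ι : Type*} [Fintype ι] {n : ℕ} (hn : 2 ≤ n)
    {p : ι → Fin n → K} (hp : ∀ i, p i ≠ 0)
    (hpp : ∀ i j, i ≠ j → ∀ t : K, p i ≠ t • p j) (i : ι) :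
    ∃ a, ∃ g ∈ ⨅ j, pointIdeal (p j), eval (p i) (pderiv a g) ≠ 0 := by
  classical
  obtain ⟨a, g, hg, hg0, hga⟩ := exists_mem_pointIdeal_pderiv_ne_zero hn (hp i)
  choose s hs hs' using fun j : {j // j ≠ i} =>
    exists_mem_pointIdeal_eval_ne_zero (hp j) (hpp i j j.2.symm)
  refine ⟨a, (∏ j, s j) * g, ?_, ?_⟩
  · rw [Ideal.mem_iInf]
    intro j
    by_cases hj : j = i
    · subst hj
      exact Ideal.mul_mem_left _ _ hg
    · exact Ideal.mul_mem_right _ _ (Ideal.mem_of_dvd _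
        (Finset.dvd_prod_of_mem s (Finset.mem_univ ⟨j, hj⟩)) (hs ⟨j, hj⟩))
  · rw [Derivation.leibniz]
    simp only [smul_eq_mul, map_add, map_mul, hg0, zero_mul, add_zero, map_prod]
    exact mul_ne_zero (Finset.prod_ne_zero_iff.mpr fun j _ => hs' j) hga

theorem eval_pderiv_eq_zero_of_mem_sq {σ : Type*} {v : σ → K} {g : MvPolynomial σ K}
    (hg : g ∈ RingHom.ker (eval v) ^ 2) (a : σ) : eval v (pderiv a g) = 0 := by
  rw [pow_two] at hg
  refine Submodule.mul_induction_on hg (fun s hs t ht => ?_) fun s t hs ht => ?_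
  · rw [RingHom.mem_ker] at hs ht
    simp [Derivation.leibniz, hs, ht]
  · simp [hs, ht]

end Points

theorem IsSyzygyPair.pow_smul_mem_of_sum_eq_zero {R : Type*} [CommRing R] {f P Q : Fin 3 → R}
    (h : IsSyzygyPair f P Q) {u : R} (hm : ∀ i, signedMinors P Q i = u * f i)
    {N : Submodule R (SymPair → R)}
    (hN : ∀ v : Fin 3 → R, ∑ i, v i * f i = 0 → ∀ k, symMul v k ∈ N) {q : SymPair → R}
    (hq : ∑ p, q p * (f p.val.1 * f p.val.2) = 0) (k : Fin 3) : P k ^ 5 • q ∈ N := by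
  have h0 := hm 0
  have h1 := hm 1
  have h2 := hm 2
  simp only [signedMinors, Matrix.cons_val] at h0 h1 h2
  rw [sum_symPair] at hq
  dsimp only at hq
  have hexp : q = ∑ p : SymPair, q p • symE p.val.1 p.val.2 := by
    rw [sum_symPair]
    funext ⟨⟨a, b⟩, hab⟩
    fin_cases a <;> fin_cases b <;> first | exact absurd hab (by decide) | simp [symE]
  rw [sum_symPair] at hexp
  dsimp only at hexp
  fin_cases k
  · refine h.pow_smul_mem (i := 1) (j := 2) (k := 0) symE_comm hN (by decide) (by decide)
      (by decide) (u := u) (by linear_combination h2) (by linear_combination -h1)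
      (q := q) (cii := q ⟨(1, 1), by decide⟩) (cij := q ⟨(1, 2), by decide⟩)
      (cjj := q ⟨(2, 2), by decide⟩) (cki := q ⟨(0, 1), by decide⟩)
      (ckj := q ⟨(0, 2), by decide⟩) (ckk := q ⟨(0, 0), by decide⟩) ?_
      (by linear_combination hq)
    linear_combination (norm := module) hexp
  · refine h.pow_smul_mem (i := 2) (j := 0) (k := 1) symE_comm hN (by decide) (by decide)
      (by decide) (u := u) (by linear_combination h0) (by linear_combination -h2)
      (q := q) (cii := q ⟨(2, 2), by decide⟩) (cij := q ⟨(0, 2), by decide⟩)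
      (cjj := q ⟨(0, 0), by decide⟩) (cki := q ⟨(1, 2), by decide⟩)
      (ckj := q ⟨(0, 1), by decide⟩) (ckk := q ⟨(1, 1), by decide⟩) ?_
      (by linear_combination hq)
    rw [symE_comm 2 0, symE_comm 1 0]
    linear_combination (norm := module) hexp
  · refine h.pow_smul_mem (i := 0) (j := 1) (k := 2) symE_comm hN (by decide) (by decide)
      (by decide) (u := u) (by linear_combination h1) (by linear_combination -h0)
      (q := q) (cii := q ⟨(0, 0), by decide⟩) (cij := q ⟨(0, 1), by decide⟩)
      (cjj := q ⟨(1, 1), by decide⟩) (cki := q ⟨(0, 2), by decide⟩)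
      (ckj := q ⟨(1, 2), by decide⟩) (ckk := q ⟨(2, 2), by decide⟩) ?_
      (by linear_combination hq)
    rw [symE_comm 2 0, symE_comm 2 1]
    linear_combination (norm := module) hexp

theorem sum_smul_symE_mul {R : Type*} [CommRing R] (f v : Fin 3 → R) (k : Fin 3) :
    ∑ p : SymPair, symMul v k p * (f p.val.1 * f p.val.2) = f k * ∑ i, v i * f i := by
  rw [sum_symPair]
  fin_cases k <;> simp [symMul, symE, Fin.sum_univ_three] <;> ring

theorem exists_eval_ne_zero_of_signedMinors {K : Type*} [Field K] {n : ℕ}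
    {f P Q : Fin 3 → MvPolynomial (Fin n) K} {u : MvPolynomial (Fin n) K} (hu : IsUnit u)
    (hm : ∀ i, signedMinors P Q i = u * f i) {v : Fin n → K} {a : Fin n}
    {g : MvPolynomial (Fin n) K} (hg : g ∈ Ideal.span (Set.range f))
    (hga : eval v (pderiv a g) ≠ 0) : ∃ k, eval v (P k) ≠ 0 ∨ eval v (Q k) ≠ 0 := by
  by_contra! hall
  refine hga (eval_pderiv_eq_zero_of_mem_sq ?_ a)
  refine (Ideal.span_le.mpr ?_ : Ideal.span (Set.range f) ≤ _) hg
  rintro _ ⟨i, rfl⟩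
  have hprod : ∀ k l, P k * Q l ∈ RingHom.ker (eval v) ^ 2 := fun k l => by
    rw [pow_two]
    exact Ideal.mul_mem_mul (hall k).1 (hall l).2
  rw [SetLike.mem_coe, ← Ideal.unit_mul_mem_iff_mem _ hu, ← hm]
  fin_cases i
  · exact Ideal.sub_mem _ (hprod 1 2) (hprod 2 1)
  · exact Ideal.sub_mem _ (hprod 2 0) (hprod 0 2)
  · exact Ideal.sub_mem _ (hprod 0 1) (hprod 1 0)

theorem mem_span_X_of_homogeneous_syzygy {K : Type*} [Field K]
    {f v : Fin 3 → MvPolynomial (Fin 3) K} {e : ℕ}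
    (hmin : ∀ i, f i ∉ Ideal.span (f '' {j | j ≠ i})) (hv : ∀ i, (v i).IsHomogeneous e)
    (hvf : ∑ i, v i * f i = 0) (i : Fin 3) :
    v i ∈ Ideal.span {(X 0 : MvPolynomial (Fin 3) K), X 1, X 2} := by
  have himage : ({X 0, X 1, X 2} : Set (MvPolynomial (Fin 3) K)) = X '' Set.univ := by
    ext t
    simp [Fin.exists_fin_succ, eq_comm]
  rw [himage, mem_ideal_span_X_image]
  intro m hm
  by_contra! hm0
  have hm' : m = 0 := Finsupp.ext fun l => hm0 l (Set.mem_univ l)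
  rw [hm', mem_support_iff] at hm
  have he : e = 0 := by
    by_contra he
    exact hm ((hv i).coeff_eq_zero (by simpa using Ne.symm he))
  have hC : v i = C (coeff 0 (v i)) :=
    totalDegree_eq_zero_iff_eq_C.mp (Nat.le_zero.mp (he ▸ (hv i).totalDegree_le))
  refine hmin i ?_
  rw [← Finset.add_sum_erase _ _ (Finset.mem_univ i)] at hvf
  rw [← Ideal.unit_mul_mem_iff_mem _ (hC ▸ (isUnit_iff_ne_zero.mpr hm).map C :
    IsUnit (v i)), eq_neg_of_add_eq_zero_left hvf]
  refine Ideal.neg_mem_iff _ |>.mpr (Ideal.sum_mem _ fun j hj => Ideal.mul_mem_left _ _ ?_)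
  exact Ideal.subset_span ⟨j, (Finset.mem_erase.mp hj).1, rfl⟩

/-- the minimal free resolution
`0 → R(−3d) → R(−2d−d₀)³ ⊕ R(−2d−d₁)³ → R(−2d)⁶ → I² → 0`
of the square of a strict almost complete intersection ideal of points in `P²`,
uniformly generated in degree `d`: the displayed sequence of maps is exact, the
last map `e_{ij} ↦ f_i f_j` has image `I²`, and the resolution is minimal
(the entries `±P_i`, `±Q_i` of the matrices lie in the irrelevant ideal). -/
theorem resolution_of_square {K : Type*} [Field K]
    (I : Ideal (MvPolynomial (Fin 3) K))
    (f P Q : Fin 3 → MvPolynomial (Fin 3) K) (d d₀ d₁ : ℕ)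
    (hpts : @DefinesReducedPoints K _ 2 I)
    (hgen : I = Ideal.span (Set.range f))
    (hmin : ∀ i, f i ∉ Ideal.span (f '' {j | j ≠ i}))
    (hdeg : ∀ i, (f i).IsHomogeneous d)
    (hP : ∀ i, (P i).IsHomogeneous d₀)
    (hQ : ∀ i, (Q i).IsHomogeneous d₁)
    (hd : d₀ + d₁ = d)
    (hsyz : ∀ v : Fin 3 → MvPolynomial (Fin 3) K,
      (∑ i, v i * f i = 0) ↔
        v ∈ Submodule.span (MvPolynomial (Fin 3) K) {P, Q}) :
    let R := MvPolynomial (Fin 3) K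
    -- first map: 1 ↦ (−Q₁,−Q₂,−Q₃,P₁,P₂,P₃)
    let α : R →ₗ[R] (Fin 3 ⊕ Fin 3 → R) :=
      LinearMap.toSpanSingleton R _ (Sum.elim (fun k => -Q k) fun k => P k)
    -- middle map: (first summand) k ↦ Σᵢ Pᵢ e_{ik},  (second summand) k ↦ Σᵢ Qᵢ e_{ik}
    let β : (Fin 3 ⊕ Fin 3 → R) →ₗ[R] (SymPair → R) :=
      (Pi.basisFun R (Fin 3 ⊕ Fin 3)).constr ℕ
        (Sum.elim (fun k => ∑ i, P i • symE i k) fun k => ∑ i, Q i • symE i k)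
    -- last map: e_{ij} ↦ f_i f_j (with image I²)
    let γ : (SymPair → R) →ₗ[R] R :=
      (Pi.basisFun R SymPair).constr ℕ fun q => f q.val.1 * f q.val.2
    Function.Injective α ∧
      LinearMap.range α = LinearMap.ker β ∧
      LinearMap.range β = LinearMap.ker γ ∧
      LinearMap.range γ = (I ^ 2 : Ideal R) ∧
      (∀ i, P i ∈ Ideal.span {(X 0 : MvPolynomial (Fin 3) K), X 1, X 2} ∧
        Q i ∈ Ideal.span {(X 0 : MvPolynomial (Fin 3) K), X 1, X 2}) := by
  intro R α β γ
  have hsyz' : IsSyzygyPair f P Q :=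
    ⟨(hsyz P).mpr (Submodule.subset_span (by simp)),
      (hsyz Q).mpr (Submodule.subset_span (by simp)), fun v hv => by
        obtain ⟨a, b, hab⟩ := Submodule.mem_span_pair.mp ((hsyz v).mp hv)
        exact ⟨a, b, fun i => by simp [← hab]⟩⟩
  have hf0 : ∀ i, f i ≠ 0 := fun i h => hmin i (h ▸ Ideal.zero_mem _)
  have hfI : ∀ i, f i ∈ I := fun i => hgen ▸ Ideal.subset_span ⟨i, rfl⟩
  obtain ⟨n, p, hp, hpp, hI⟩ := hpts
  have hprime : ∀ q : Ideal R, q.IsPrime → I ≤ q → ∃ i, pointIdeal (p i) ≤ q := by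
    intro q hq hle
    rw [hI, ← Finset.inf_univ_eq_iInf, hq.inf_le'] at hle
    obtain ⟨i, -, hi⟩ := hle
    exact ⟨i, hi⟩
  obtain ⟨u, hu, hm⟩ := hsyz'.exists_unit_signedMinors (hf0 0) (fun π hπ => by
    by_contra! hall
    obtain ⟨i, hi⟩ := hprime (Ideal.span {π})
      ((Ideal.span_singleton_prime hπ.ne_zero).mpr hπ) (by
        rw [hgen, Ideal.span_le]
        rintro _ ⟨i, rfl⟩
        exact Ideal.mem_span_singleton.mpr (hall i))
    exact not_pointIdeal_le_span_singleton (hp i) hπ.not_isUnit hi)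
  have hm0 : ∀ i, signedMinors P Q i ≠ 0 := fun i => by
    rw [hm]
    exact mul_ne_zero hu.ne_zero (hf0 i)
  have hsmooth : ∀ i, ∃ k, eval (p i) (P k) ≠ 0 ∨ eval (p i) (Q k) ≠ 0 := fun i => by
    obtain ⟨a, g, hg, hga⟩ := exists_mem_iInf_pderiv_ne_zero (by norm_num) hp hpp i
    exact exists_eval_ne_zero_of_signedMinors hu hm (hgen ▸ hI ▸ hg) hga
  have hβ : ∀ a, β a = ∑ k, a (Sum.inl k) • symMul P k + ∑ k, a (Sum.inr k) • symMul Q k := by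
    intro a
    simp [β, Module.Basis.constr_apply_fintype, symMul]
  have hγ : ∀ q, γ q = ∑ s, q s * (f s.val.1 * f s.val.2) := by
    intro q
    simp [γ, Module.Basis.constr_apply_fintype]
  have hα : ∀ c, α c = Sum.elim (fun k => c * -Q k) fun k => c * P k := by
    intro c
    ext (k | k) <;> simp [α]
  have hαinj : Function.Injective α := by
    rw [injective_iff_map_eq_zero]
    intro c hc
    rw [hα] at hc
    by_contra hc0
    have hP0 : ∀ k, P k = 0 := fun k => by
      simpa [hc0] using congrFun hc (Sum.inr k)
    exact hm0 0 (by simp [signedMinors, hP0])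
  have hαβ : LinearMap.range α = LinearMap.ker β := by
    ext a
    rw [LinearMap.mem_ker, hβ]
    constructor
    · rintro ⟨c, rfl⟩
      rw [hα]
      funext ⟨⟨i, j⟩, hij⟩
      fin_cases i <;> fin_cases j <;> simp [symMul, symE, Fin.sum_univ_three] <;> ring
    · intro ha
      obtain ⟨c, hc, hc'⟩ := hsyz'.exists_eq_of_sum_symMul_eq_zero hm0 ha
      refine ⟨c, ?_⟩
      rw [hα]
      ext (k | k)
      · exact (congrArg _ (hc k)).symm
      · exact (congrArg _ (hc' k)).symm
  have hN : ∀ v : Fin 3 → R, ∑ i, v i * f i = 0 → ∀ k, symMul v k ∈ LinearMap.range β := by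
    intro v hv k
    obtain ⟨a, b, hab⟩ := hsyz'.exists_eq v hv
    refine ⟨Sum.elim (Pi.single k a) (Pi.single k b), ?_⟩
    rw [hβ]
    simp [symMul, hab, add_smul, mul_smul, Finset.sum_add_distrib, Finset.smul_sum,
      Pi.single_apply]
  have hβγ : LinearMap.range β = LinearMap.ker γ := by
    apply le_antisymm
    · rintro _ ⟨a, rfl⟩
      have hγs : ∀ v : Fin 3 → R, ∑ i, v i * f i = 0 → ∀ k, γ (symMul v k) = 0 := by
        intro v hv k
        rw [hγ, sum_smul_symE_mul, hv, mul_zero]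
      rw [LinearMap.mem_ker, hβ]
      simp [hγs P hsyz'.left, hγs Q hsyz'.right]
    · intro q hq
      rw [LinearMap.mem_ker, hγ] at hq
      have hPq := hsyz'.pow_smul_mem_of_sum_eq_zero hm hN hq
      have hQq := hsyz'.swap.pow_smul_mem_of_sum_eq_zero (u := -u) (fun i => by
        rw [neg_mul, ← hm]
        fin_cases i <;> simp [signedMinors] <;> ring) hN hq
      let J : Ideal R := (LinearMap.range β).comap (LinearMap.toSpanSingleton R _ q)
      have hJ : ∀ r, r ∈ J ↔ r • q ∈ LinearMap.range β := fun r => Iff.rfl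
      have hrad : ∀ i, X i ∈ J.radical := by
        intro i
        rw [Ideal.radical_eq_sInf, Ideal.mem_sInf]
        rintro 𝔮 ⟨hJq, hq'⟩
        have hP' : ∀ k, P k ∈ 𝔮 := fun k => hq'.mem_of_pow_mem 5 (hJq (hPq k))
        have hQ' : ∀ k, Q k ∈ 𝔮 := fun k => hq'.mem_of_pow_mem 5 (hJq (hQq k))
        obtain ⟨j, hj⟩ := hprime 𝔮 hq' (by
          rw [hgen, Ideal.span_le]
          rintro _ ⟨j, rfl⟩
          rw [SetLike.mem_coe, ← Ideal.unit_mul_mem_iff_mem _ hu, ← hm]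
          fin_cases j <;>
            exact 𝔮.sub_mem (𝔮.mul_mem_right _ (hP' _)) (𝔮.mul_mem_right _ (hP' _)))
        obtain ⟨k, hk | hk⟩ := hsmooth j
        · exact X_mem_of_pointIdeal_le (hp j) hq' hj (hP k) (hP' k) hk i
        · exact X_mem_of_pointIdeal_le (hp j) hq' hj (hQ k) (hQ' k) hk i
      choose e he using hrad
      have he' : ∀ i, X i ^ (e 0 + e 1 + e 2) • q ∈ LinearMap.range β := fun i => by
        rw [← hJ]
        refine J.mem_of_dvd (pow_dvd_pow _ ?_) (he i)
        fin_cases i <;> simp <;> omega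
      refine mem_range_of_regular_smul_mem hαinj hαβ (fun b hb => ?_) (fun a b hab => ?_)
        (fun a b c habc => ?_) (he' 0) (he' 1) (he' 2)
      · exact (smul_eq_zero.mp hb).resolve_left (pow_ne_zero _ (X_ne_zero 0))
      · have hdvd := fun s => X_pow_dvd_of_mul_eq (i := (0 : Fin 3)) (j := 1) (by decide)
          (e 0 + e 1 + e 2) (congrFun hab s)
        choose c hc using hdvd
        exact ⟨c, funext hc⟩
      · exact exists_eq_of_X_pow_mul_eq (by decide) (by decide) _ habc
  have hγI : LinearMap.range γ = (I ^ 2 : Ideal R) := by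
    apply le_antisymm
    · rintro _ ⟨q, rfl⟩
      rw [hγ, pow_two]
      exact Ideal.sum_mem _ fun s _ => Ideal.mul_mem_left _ _ (Ideal.mul_mem_mul (hfI _) (hfI _))
    · rw [pow_two, hgen, Ideal.span_mul_span', Ideal.span, Submodule.span_le]
      rintro _ ⟨_, ⟨i, rfl⟩, _, ⟨j, rfl⟩, rfl⟩
      have hij : ∀ i j, i ≤ j → f i * f j ∈ LinearMap.range γ := fun i j h =>
        ⟨Pi.single ⟨(i, j), h⟩ 1, by simp [hγ, Pi.single_apply]⟩
      rcases le_total i j with h | h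
      · exact hij i j h
      · change f i * f j ∈ _
        rw [mul_comm]
        exact hij j i h
  exact ⟨hαinj, hαβ, hβγ, hγI, fun i =>
    ⟨mem_span_X_of_homogeneous_syzygy hmin hP hsyz'.left i,
      mem_span_X_of_homogeneous_syzygy hmin hQ hsyz'.right i⟩⟩

end
end
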